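/- arXiv:1002.2662 — 5 statements merged into one kernel-verified Lean document; each statement's English description precedes it below -/
import Mathlib

section
/- Fix integers N ≥ 2 and m ≥ 1. Let x_1,…,x_m and B_1,…,B_N be independent indeterminates over ℂ, let p_k(X) = Σ_{i=1}^m x_i^k be the power sums, and define f(X) := p_{N+1}(X) + Σ_{k=1}^{N} (−1)^{N+1−k} ((N+1)/k) · B_{N+1−k} · p_k(X) ∈ ℂ[B_1,…,B_N][x_1,…,x_m]. Since f is symmetric in x_1,…,x_m and the elementary symmetric polynomials e_1(X),…,e_m(X) are algebraically independent over ℂ[B_1,…,B_N], there is a unique polynomial F ∈ ℂ[B_1,…,B_N][X_1,…,X_m] with F(e_1(X),…,e_m(X)) = f(X). Then for every 1 ≤ j ≤ m: (∂F/∂X_j)(e_1(X),…,e_m(X)) = (−1)^{j+1}(N+1)·( h_{N+1−j}(X) + Σ_{k=1}^{N} (−1)^{N+1−k} B_{N+1−k} h_{k−j}(X) ). Moreover, if 𝔹 is an alphabet of N further indeterminates disjoint from X and each B_k is specialized to e_k(𝔹), then (∂F/∂X_j)(e_1(X),…,e_m(X)) = (−1)^{j+1}(N+1)·h_{N+1−j}(X−𝔹).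 -/
/-!
Statement 2: derivative of the deformed potential.  With
`f(X) = p_{N+1}(X) + Σ_{k=1}^N (−1)^{N+1−k} ((N+1)/k) B_{N+1−k} p_k(X)` and `F` the unique
polynomial in new indeterminates `X_1,…,X_m` over `ℂ[B_1,…,B_N]` with
`F(e_1(X),…,e_m(X)) = f(X)`, one has, for `1 ≤ j ≤ m`,
`(∂F/∂X_j)(e_1,…,e_m) = (−1)^{j+1}(N+1)(h_{N+1−j}(X) + Σ_{k=1}^N (−1)^{N+1−k} B_{N+1−k} h_{k−j}(X))`,
and after specializing `B_k ↦ e_k(𝔹)` this equals `(−1)^{j+1}(N+1) h_{N+1−j}(X−𝔹)`.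

Here `j : Fin m` denotes the `(j+1)`-st variable (1-based index `J = j+1`), and `k : Fin N`
runs over the 1-based summation index `k+1 ∈ {1,…,N}`; the `1`-based `B_{N+1-(k+1)} = B_{N-k}`
is the variable `X (Fin.rev k)` of `ℂ[B_1,…,B_N] = MvPolynomial (Fin N) ℂ`.
-/

open MvPolynomial

/-- The `j`-th elementary symmetric polynomial in the variables of the finset `A`. -/
noncomputable def esymmF {σ : Type*} [DecidableEq σ] (A : Finset σ) (j : ℕ) :
    MvPolynomial σ ℂ :=
  ∑ s ∈ A.powersetCard j, ∏ i ∈ s, X i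

/-- The `j`-th complete homogeneous symmetric polynomial in the variables of the finset `A`. -/
noncomputable def hsymmF {σ : Type*} [DecidableEq σ] (A : Finset σ) (j : ℕ) :
    MvPolynomial σ ℂ :=
  ∑ m ∈ A.sym j, ((m : Multiset σ).map X).prod

/-- `h_k(X−Y) := Σ_{j=0}^{k} (−1)^j e_j(Y) h_{k−j}(X)`. -/
noncomputable def hdiff {σ : Type*} [DecidableEq σ] (A B : Finset σ) (k : ℕ) :
    MvPolynomial σ ℂ :=
  ∑ j ∈ Finset.range (k + 1), (-1 : MvPolynomial σ ℂ) ^ j * esymmF B j * hsymmF A (k - j)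

/-- `h_n(X−Y)` for an integer index `n`, vanishing for `n < 0`. -/
noncomputable def hdiffZ {σ : Type*} [DecidableEq σ] (A B : Finset σ) (n : ℤ) :
    MvPolynomial σ ℂ :=
  if 0 ≤ n then hdiff A B n.toNat else 0

/-- Complete homogeneous symmetric polynomial with an integer index, vanishing for
negative index. -/
noncomputable def hsymmZ (σ R : Type*) [CommSemiring R] [Fintype σ] [DecidableEq σ] (n : ℤ) :
    MvPolynomial σ R :=
  if 0 ≤ n then hsymm σ R n.toNat else 0

section SymmetricFunctions

variable {σ S : Type*} [CommRing S]

/-- The `n`-th elementary symmetric function of the values of `f` on the finset `A`. -/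
def esymmOn (f : σ → S) (A : Finset σ) (n : ℕ) : S :=
  ∑ s ∈ A.powersetCard n, ∏ i ∈ s, f i

/-- The `n`-th complete homogeneous symmetric function of the values of `f` on the finset `A`. -/
def hsymmOn [DecidableEq σ] (f : σ → S) (A : Finset σ) (n : ℕ) : S :=
  ∑ s ∈ A.sym n, ((s : Multiset σ).map f).prod

@[simp]
lemma esymmOn_zero (f : σ → S) (A : Finset σ) : esymmOn f A 0 = 1 := by
  simp [esymmOn]

lemma esymmOn_eq_zero (f : σ → S) (A : Finset σ) {n : ℕ} (h : A.card < n) :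
    esymmOn f A n = 0 := by
  simp [esymmOn, Finset.powersetCard_eq_empty.2 h]

variable [DecidableEq σ]

lemma esymmOn_insert_succ (f : σ → S) {A : Finset σ} {a : σ} (ha : a ∉ A) (n : ℕ) :
    esymmOn f (insert a A) (n + 1) = esymmOn f A (n + 1) + f a * esymmOn f A n := by
  have key : ∀ s ∈ A.powersetCard n, a ∉ s := fun s hs h =>
    ha ((Finset.mem_powersetCard.1 hs).1 h)
  unfold esymmOn
  rw [Finset.powersetCard_succ_insert ha, Finset.sum_union, Finset.sum_image, Finset.mul_sum]
  · congr 1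
    exact Finset.sum_congr rfl fun s hs => Finset.prod_insert (key s hs)
  · intro s hs t ht hst
    rw [← Finset.erase_insert (key s hs), ← Finset.erase_insert (key t ht)]
    exact congrArg (fun u => Finset.erase u a) hst
  · rw [Finset.disjoint_left]
    intro s hs hs'
    obtain ⟨t, -, rfl⟩ := Finset.mem_image.1 hs'
    exact ha ((Finset.mem_powersetCard.1 hs).1 (Finset.mem_insert_self a t))

@[simp]
lemma hsymmOn_zero (f : σ → S) (A : Finset σ) : hsymmOn f A 0 = 1 := by
  rw [hsymmOn, Finset.sym_zero, Finset.sum_singleton]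
  rfl

lemma hsymmOn_insert_succ (f : σ → S) {A : Finset σ} {a : σ} (ha : a ∉ A) (n : ℕ) :
    hsymmOn f (insert a A) (n + 1) = hsymmOn f A (n + 1) + f a * hsymmOn f (insert a A) n := by
  have hsplit : (insert a A).sym (n + 1) =
      A.sym (n + 1) ∪ ((insert a A).sym n).image (Sym.cons a) := by
    ext s
    simp only [Finset.mem_union, Finset.mem_image, Finset.mem_sym_iff]
    constructor
    · intro h
      by_cases has : a ∈ s
      · exact Or.inr ⟨s.erase a has, fun b hb => h b (Multiset.mem_of_mem_erase hb),
          Sym.cons_erase has⟩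
      · exact Or.inl fun b hb => (Finset.mem_insert.1 (h b hb)).resolve_left
          fun hba => has (hba ▸ hb)
    · rintro (h | ⟨t, ht, rfl⟩) b hb
      · exact Finset.mem_insert_of_mem (h b hb)
      · rcases Sym.mem_cons.1 hb with rfl | hb
        · exact Finset.mem_insert_self _ _
        · exact ht b hb
  unfold hsymmOn
  rw [hsplit, Finset.sum_union, Finset.sum_image, Finset.mul_sum]
  · congr 1
    exact Finset.sum_congr rfl fun s _ => by
      rw [Sym.coe_cons, Multiset.map_cons, Multiset.prod_cons]
  · intro s _ t _ hst
    exact (Sym.cons_inj_right a s t).1 hst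
  · rw [Finset.disjoint_left]
    intro s hs hs'
    obtain ⟨t, -, rfl⟩ := Finset.mem_image.1 hs'
    exact ha (Finset.mem_sym_iff.1 hs a (Sym.mem_cons_self a t))

lemma map_hsymmOn {T : Type*} [CommRing T] (φ : S →+* T) (f : σ → S) (A : Finset σ) (n : ℕ) :
    φ (hsymmOn f A n) = hsymmOn (fun i => φ (f i)) A n := by
  simp [hsymmOn, map_sum, map_multiset_prod, Multiset.map_map]

lemma hsymmOn_map {τ : Type*} [DecidableEq τ] (g : τ ↪ σ) (f : σ → S) (A : Finset τ) (n : ℕ) :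
    hsymmOn f (A.map g) n = hsymmOn (fun i => f (g i)) A n := by
  unfold hsymmOn
  rw [Finset.sym_map, Finset.sum_map]
  refine Finset.sum_congr rfl fun s _ => ?_
  simp [Sym.coe_map, Multiset.map_map]

/-- The generating series `∏ (1 - f i t)` of the signed elementary symmetric functions. -/
def esymmSeries (f : σ → S) (A : Finset σ) : PowerSeries S :=
  PowerSeries.mk fun n => (-1) ^ n * esymmOn f A n

/-- The generating series of the complete homogeneous symmetric functions. -/
def hsymmSeries (f : σ → S) (A : Finset σ) : PowerSeries S :=
  PowerSeries.mk fun n => hsymmOn f A n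

lemma esymmSeries_insert (f : σ → S) {A : Finset σ} {a : σ} (ha : a ∉ A) :
    esymmSeries f (insert a A) =
      (1 - PowerSeries.C (f a) * PowerSeries.X) * esymmSeries f A := by
  ext n
  rw [sub_mul, one_mul, mul_assoc, map_sub, PowerSeries.coeff_C_mul]
  cases n with
  | zero => simp [esymmSeries]
  | succ n =>
    rw [PowerSeries.coeff_succ_X_mul]
    simp only [esymmSeries, PowerSeries.coeff_mk, esymmOn_insert_succ f ha]
    ring

lemma hsymmSeries_eq_insert (f : σ → S) {A : Finset σ} {a : σ} (ha : a ∉ A) :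
    hsymmSeries f A =
      (1 - PowerSeries.C (f a) * PowerSeries.X) * hsymmSeries f (insert a A) := by
  ext n
  rw [sub_mul, one_mul, mul_assoc, map_sub, PowerSeries.coeff_C_mul]
  cases n with
  | zero => simp [hsymmSeries]
  | succ n =>
    rw [PowerSeries.coeff_succ_X_mul]
    simp only [hsymmSeries, PowerSeries.coeff_mk, hsymmOn_insert_succ f ha]
    ring

lemma esymmSeries_mul_hsymmSeries (f : σ → S) (A : Finset σ) :
    esymmSeries f A * hsymmSeries f A = 1 := by
  induction A using Finset.induction_on with
  | empty =>
    have h1 : esymmSeries f (∅ : Finset σ) = 1 := by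
      ext n
      cases n with
      | zero => simp [esymmSeries]
      | succ n =>
        simp [esymmSeries, PowerSeries.coeff_one, esymmOn_eq_zero f ∅ (Nat.succ_pos n)]
    have h2 : hsymmSeries f (∅ : Finset σ) = 1 := by
      ext n
      cases n with
      | zero => simp [hsymmSeries]
      | succ n => simp [hsymmSeries, hsymmOn, PowerSeries.coeff_one]
    rw [h1, h2, one_mul]
  | insert a A ha ih =>
    rw [esymmSeries_insert f ha, mul_right_comm, ← hsymmSeries_eq_insert f ha, mul_comm, ih]

lemma sum_esymmOn_mul_hsymmOn_insert (f : σ → S) {A : Finset σ} {a : σ} (ha : a ∉ A) (n : ℕ) :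
    ∑ i ∈ Finset.range (n + 1), (-1) ^ i * esymmOn f A i * hsymmOn f (insert a A) (n - i) =
      f a ^ n := by
  have hcoeff : ∀ n, PowerSeries.coeff n (esymmSeries f A * hsymmSeries f (insert a A)) =
      f a ^ n := by
    have h := esymmSeries_mul_hsymmSeries f A
    rw [hsymmSeries_eq_insert f ha, mul_left_comm, sub_mul, one_mul, mul_assoc,
      sub_eq_iff_eq_add] at h
    intro n
    induction n with
    | zero => rw [h]; simp
    | succ n ih =>
      rw [h, map_add, PowerSeries.coeff_C_mul, PowerSeries.coeff_succ_X_mul, ih,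
        PowerSeries.coeff_one, if_neg n.succ_ne_zero, zero_add, pow_succ']
  rw [← hcoeff n, PowerSeries.coeff_mul, Finset.Nat.sum_antidiagonal_eq_sum_range_succ_mk]
  simp [esymmSeries, hsymmSeries]

lemma esymmOn_univ_succ [Fintype σ] (f : σ → S) (l : σ) (n : ℕ) :
    esymmOn f Finset.univ (n + 1) =
      esymmOn f (Finset.univ.erase l) (n + 1) + f l * esymmOn f (Finset.univ.erase l) n := by
  rw [← esymmOn_insert_succ f (Finset.notMem_erase l _), Finset.insert_erase (Finset.mem_univ l)]

end SymmetricFunctions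

section Jacobian

variable {R : Type*} [CommRing R] {m : ℕ}

/-- The elementary symmetric polynomials in all variables but the `l`-th, as values at `X l` of
monic polynomials, one in each degree. -/
lemma exists_monic_eval_eq_esymmOn_erase (n : ℕ) :
    ∃ p : Polynomial (MvPolynomial (Fin m) R), p.Monic ∧ (Nontrivial R → p.natDegree = n) ∧
      ∀ l : Fin m, p.eval (X l) = (-1) ^ n * esymmOn X (Finset.univ.erase l) n := by
  induction n with
  | zero => exact ⟨1, Polynomial.monic_one, fun _ => Polynomial.natDegree_one, fun l => by simp⟩
  | succ n ih =>
    obtain ⟨p, hp, hdeg, heval⟩ := ih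
    by_cases hR : Nontrivial R
    · have hlt : (Polynomial.C ((-1) ^ (n + 1) *
          esymmOn (X : Fin m → MvPolynomial (Fin m) R) Finset.univ (n + 1))).degree <
          (p * Polynomial.X).degree := by
        refine lt_of_le_of_lt Polynomial.degree_C_le ?_
        rw [← Polynomial.natDegree_pos_iff_degree_pos, Polynomial.natDegree_mul_X hp.ne_zero]
        exact Nat.succ_pos _
      refine ⟨p * Polynomial.X + Polynomial.C ((-1) ^ (n + 1) *
        esymmOn X Finset.univ (n + 1)), (hp.mul Polynomial.monic_X).add_of_left hlt,
        fun _ => ?_, fun l => ?_⟩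
      · rw [Polynomial.natDegree_eq_of_degree_eq (Polynomial.degree_add_eq_left_of_degree_lt hlt),
          Polynomial.natDegree_mul_X hp.ne_zero, hdeg hR]
      · rw [esymmOn_univ_succ _ l]
        simp only [Polynomial.eval_add, Polynomial.eval_mul, Polynomial.eval_X,
          Polynomial.eval_C, heval]
        ring
    · have := not_nontrivial_iff_subsingleton.1 hR
      exact ⟨1, Polynomial.monic_one, fun h => absurd h hR, fun l => Subsingleton.elim _ _⟩

lemma eq_of_sum_mul_esymmOn_erase_eq [IsDomain R] {a b : Fin m → MvPolynomial (Fin m) R}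
    (h : ∀ l : Fin m, ∑ i : Fin m, a i * esymmOn X (Finset.univ.erase l) i =
      ∑ i : Fin m, b i * esymmOn X (Finset.univ.erase l) i) : a = b := by
  choose p hp hdeg heval using fun n : ℕ => exists_monic_eval_eq_esymmOn_erase (R := R) (m := m) n
  have hdet : (Matrix.of fun l i : Fin m => (p i).eval (X l : MvPolynomial (Fin m) R)).det ≠ 0 := by
    rw [← Matrix.det_eval_matrixOfPolynomials_eq_det_vandermonde _ (fun i : Fin m => p i)
      (fun i => hdeg i inferInstance) fun i => hp i]
    exact Matrix.det_vandermonde_ne_zero_iff.2 (X_injective)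
  have hzero := Matrix.eq_zero_of_mulVec_eq_zero hdet
    (v := fun i : Fin m => (-1) ^ (i : ℕ) * (a i - b i)) (by
      ext1 l
      simp only [Matrix.mulVec, dotProduct, Matrix.of_apply, heval, Pi.zero_apply]
      rw [← sub_eq_zero.2 (h l), ← Finset.sum_sub_distrib]
      refine Finset.sum_congr rfl fun i _ => ?_
      have hsq : ((-1 : MvPolynomial (Fin m) R) ^ (i : ℕ)) * (-1) ^ (i : ℕ) = 1 := by
        rw [← mul_pow]; simp
      linear_combination (esymmOn X (Finset.univ.erase l) i * (a i - b i)) * hsq)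
  ext1 i
  have hi := congrFun hzero i
  simp only [Pi.zero_apply] at hi
  exact sub_eq_zero.1 ((mul_eq_zero.1 hi).resolve_left (pow_ne_zero _ (by simp)))

lemma pderiv_esymmOn_of_notMem {σ : Type*} (l : σ) {A : Finset σ} (hl : l ∉ A) (n : ℕ) :
    pderiv l (esymmOn (X : σ → MvPolynomial σ R) A n) = 0 := by
  classical
  unfold esymmOn
  rw [map_sum]
  refine Finset.sum_eq_zero fun s hs => ?_
  have hs' := (Finset.mem_powersetCard.1 hs).1
  have hls : l ∉ s := fun h => hl (hs' h)
  clear hs hs'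
  induction s using Finset.induction_on with
  | empty => simp
  | insert a s ha ih =>
    rw [Finset.prod_insert ha, pderiv_mul, ih fun h => hls (Finset.mem_insert_of_mem h),
      pderiv_X_of_ne (ne_of_mem_of_not_mem (Finset.mem_insert_self a s) hls)]
    simp

lemma pderiv_esymm_succ (l : Fin m) (n : ℕ) :
    pderiv l (esymm (Fin m) R (n + 1)) = esymmOn X (Finset.univ.erase l) n := by
  have h : esymm (Fin m) R (n + 1) = esymmOn X Finset.univ (n + 1) := rfl
  rw [h, esymmOn_univ_succ _ l, map_add, pderiv_mul,
    pderiv_esymmOn_of_notMem _ (Finset.notMem_erase l _),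
    pderiv_esymmOn_of_notMem _ (Finset.notMem_erase l _)]
  simp

lemma pderiv_psum_succ (l : Fin m) (n : ℕ) :
    pderiv l (psum (Fin m) R (n + 1)) = ((n : MvPolynomial (Fin m) R) + 1) * X l ^ n := by
  unfold psum
  rw [map_sum, Finset.sum_eq_single l]
  · rw [pderiv_pow, pderiv_X_self]
    simp
  · intro i _ hi
    rw [pderiv_pow, pderiv_X_of_ne hi, mul_zero]
  · simp

/-- The chain rule for partial derivatives of polynomials. -/
lemma pderiv_aeval {σ τ : Type*} [Fintype σ] (l : τ) (g : σ → MvPolynomial τ R)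
    (p : MvPolynomial σ R) :
    pderiv l (aeval g p) = ∑ i, aeval g (pderiv i p) * pderiv l (g i) := by
  classical
  induction p using MvPolynomial.induction_on with
  | C r => simp [algebraMap_eq]
  | add p q hp hq => simp only [map_add, hp, hq, add_mul, Finset.sum_add_distrib]
  | mul_X p i hp =>
    simp only [map_mul, aeval_X, pderiv_mul, hp, pderiv_X, map_add, add_mul,
      Finset.sum_add_distrib, Finset.sum_mul]
    congr 1
    · exact Finset.sum_congr rfl fun j _ => by ring
    · rw [Finset.sum_eq_single i]
      · simp
      · intro j _ hj
        simp [Pi.single_eq_of_ne hj.symm]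
      · simp

lemma hsymm_eq_hsymmOn (n : ℕ) : hsymm (Fin m) R n = hsymmOn X Finset.univ n := by
  simp [hsymm, hsymmOn, Finset.sym_univ]

lemma sum_hsymmZ_mul_esymmOn_erase (l : Fin m) (n : ℕ) :
    ∑ i : Fin m, (-1) ^ (i : ℕ) * hsymmZ (Fin m) R ((n : ℤ) - (i : ℕ)) *
      esymmOn X (Finset.univ.erase l) i = X l ^ n := by
  have hm : 0 < m := l.pos
  set g : ℕ → MvPolynomial (Fin m) R := fun i =>
    (-1) ^ i * hsymmZ (Fin m) R ((n : ℤ) - i) * esymmOn X (Finset.univ.erase l) i with hg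
  have h1 : ∀ i, m ≤ i → g i = 0 := fun i hi => by
    rw [hg]
    simp only
    rw [esymmOn_eq_zero, mul_zero]
    rw [Finset.card_erase_of_mem (Finset.mem_univ l), Finset.card_fin]
    omega
  have h2 : ∀ i, n + 1 ≤ i → g i = 0 := fun i hi => by
    have hneg : ¬ (0 : ℤ) ≤ (n : ℤ) - i := by omega
    simp only [hg, hsymmZ, if_neg hneg, mul_zero, zero_mul]
  have h3 : ∀ a b, (∀ i, a ≤ i → g i = 0) →
      ∑ i ∈ Finset.range (a + b), g i = ∑ i ∈ Finset.range a, g i := fun a b h => by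
    rw [Finset.sum_range_add, add_eq_left]
    exact Finset.sum_eq_zero fun i _ => h _ (Nat.le_add_right _ _)
  rw [← sum_esymmOn_mul_hsymmOn_insert X (Finset.notMem_erase l Finset.univ),
    Finset.insert_erase (Finset.mem_univ l), Fin.sum_univ_eq_sum_range g m, ← h3 m (n + 1) h1,
    add_comm, h3 (n + 1) m h2]
  refine Finset.sum_congr rfl fun i hi => ?_
  have hi' : i ≤ n := Nat.lt_succ_iff.1 (Finset.mem_range.1 hi)
  have hz : (n : ℤ) - i = ((n - i : ℕ) : ℤ) := by omega
  simp only [hg]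
  rw [hz, hsymmZ, if_pos (Int.natCast_nonneg _), Int.toNat_natCast, hsymm_eq_hsymmOn]
  ring

end Jacobian

section DeformedPotential

variable {N m : ℕ}

lemma div_smul_natCast_add_one {S : Type*} [CommRing S] [Algebra ℂ S] (k : ℕ) :
    ((N + 1 : ℂ) / (k + 1 : ℂ)) • ((k : S) + 1) = (N : S) + 1 := by
  rw [Algebra.smul_def]
  have h := congrArg (algebraMap ℂ S)
    (div_mul_cancel₀ (N + 1 : ℂ) (Nat.cast_add_one_ne_zero k : (k + 1 : ℂ) ≠ 0))
  rw [map_mul] at h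
  simpa only [map_add, map_natCast, map_one] using h

lemma pderiv_smul_C_mul_psum {R : Type*} [CommRing R] [Algebra ℂ R] (l : Fin m) (n k : ℕ) (b : R) :
    pderiv l ((-1 : MvPolynomial (Fin m) R) ^ n *
      (((N + 1 : ℂ) / (k + 1 : ℂ)) • (C b * psum (Fin m) R (k + 1)))) =
      (-1) ^ n * ((N : MvPolynomial (Fin m) R) + 1) * C b * X l ^ k := by
  have hsign : (-1 : MvPolynomial (Fin m) R) ^ n = C ((-1) ^ n) := by simp
  rw [hsign, pderiv_C_mul, Derivation.map_smul_of_tower, pderiv_C_mul, pderiv_psum_succ,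
    ← div_smul_natCast_add_one (N := N) (S := MvPolynomial (Fin m) R) k]
  simp only [Algebra.smul_def]
  ring

lemma sum_mul_add_sum_mul_eq {S : Type*} [CommRing S] (s e : Fin m → S) (c x : S)
    (H : ℕ → Fin m → S) (N : ℕ) (d β : Fin N → S)
    (h : ∀ n, ∑ i, s i * H n i * e i = x ^ n) :
    ∑ i, s i * c * (H N i + ∑ k : Fin N, d k * β k * H k i) * e i =
      c * x ^ N + ∑ k : Fin N, d k * c * β k * x ^ (k : ℕ) := by
  simp only [← h, Finset.mul_sum]
  rw [Finset.sum_comm, ← Finset.sum_add_distrib]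
  refine Finset.sum_congr rfl fun i _ => ?_
  rw [mul_add, add_mul, Finset.mul_sum, Finset.sum_mul]
  congr 1
  · ring
  · exact Finset.sum_congr rfl fun k _ => by ring

/-- The gradient of the deformed potential, read off along the Jacobian of the elementary
symmetric polynomials. -/
lemma sum_hsymmZ_add_sum_mul_esymmOn_erase {R : Type*} [CommRing R] (l : Fin m) (b : Fin N → R) :
    ∑ i : Fin m, (-1 : MvPolynomial (Fin m) R) ^ (i : ℕ) * ((N : MvPolynomial (Fin m) R) + 1) *
        (hsymmZ (Fin m) R ((N : ℤ) - (i : ℕ)) +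
          ∑ k : Fin N, (-1 : MvPolynomial (Fin m) R) ^ (N - (k : ℕ)) * C (b k) *
            hsymmZ (Fin m) R (((k : ℕ) : ℤ) - ((i : ℕ) : ℤ))) *
        esymmOn X (Finset.univ.erase l) i =
      ((N : MvPolynomial (Fin m) R) + 1) * X l ^ N +
        ∑ k : Fin N, (-1 : MvPolynomial (Fin m) R) ^ (N - (k : ℕ)) *
          ((N : MvPolynomial (Fin m) R) + 1) * C (b k) * X l ^ (k : ℕ) := by
  exact sum_mul_add_sum_mul_eq (fun i : Fin m => (-1) ^ (i : ℕ)) _ _ _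
    (fun n i => hsymmZ (Fin m) R ((n : ℤ) - (i : ℕ))) _ _ _ (sum_hsymmZ_mul_esymmOn_erase l)

end DeformedPotential

section Specialization

/-- The specialization `B_t ↦ e_t(𝔹)`, `x_i ↦ X (inl i)` used in the deformed potential. -/
noncomputable def specializeB (N m : ℕ) :
    MvPolynomial (Fin m) (MvPolynomial (Fin N) ℂ) →+* MvPolynomial (Fin m ⊕ Fin N) ℂ :=
  eval₂Hom
    ((aeval (fun t : Fin N =>
        esymmF (Finset.univ.image (Sum.inr : Fin N → Fin m ⊕ Fin N)) ((t : ℕ) + 1))) :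
      MvPolynomial (Fin N) ℂ →ₐ[ℂ] MvPolynomial (Fin m ⊕ Fin N) ℂ).toRingHom
    (fun i : Fin m => X (Sum.inl i))

lemma specializeB_C_X (N m : ℕ) (t : Fin N) :
    specializeB N m (C (X t)) =
      esymmF (Finset.univ.image (Sum.inr : Fin N → Fin m ⊕ Fin N)) ((t : ℕ) + 1) := by
  simp [specializeB]

lemma specializeB_hsymm (N m n : ℕ) :
    specializeB N m (hsymm (Fin m) (MvPolynomial (Fin N) ℂ) n) =
      hsymmF (Finset.univ.image (Sum.inl : Fin m → Fin m ⊕ Fin N)) n := by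
  have h : hsymmF (Finset.univ.image (Sum.inl : Fin m → Fin m ⊕ Fin N)) n =
      hsymmOn X (Finset.univ.map ⟨Sum.inl, Sum.inl_injective⟩) n := by
    rw [Finset.map_eq_image]
    rfl
  rw [h, hsymmOn_map, hsymm_eq_hsymmOn, map_hsymmOn]
  simp [specializeB]

lemma specializeB_hsymmZ_add_sum (N m j : ℕ) :
    specializeB N m (hsymmZ (Fin m) (MvPolynomial (Fin N) ℂ) ((N : ℤ) - j) +
        ∑ k : Fin N, (-1) ^ (N - (k : ℕ)) * C (X (Fin.rev k)) *
          hsymmZ (Fin m) (MvPolynomial (Fin N) ℂ) (((k : ℕ) : ℤ) - j)) =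
      hdiffZ (Finset.univ.image (Sum.inl : Fin m → Fin m ⊕ Fin N))
        (Finset.univ.image (Sum.inr : Fin N → Fin m ⊕ Fin N)) ((N : ℤ) - j) := by
  set A := Finset.univ.image (Sum.inl : Fin m → Fin m ⊕ Fin N)
  set B := Finset.univ.image (Sum.inr : Fin N → Fin m ⊕ Fin N)
  have hZ_neg : ∀ a : ℕ, a < j →
      hsymmZ (Fin m) (MvPolynomial (Fin N) ℂ) ((a : ℤ) - j) = 0 := fun a ha =>
    if_neg (by omega)
  have hZ_add : ∀ a : ℕ, specializeB N m
      (hsymmZ (Fin m) (MvPolynomial (Fin N) ℂ) (((j + a : ℕ) : ℤ) - j)) = hsymmF A a := fun a => by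
    have ha : ((j + a : ℕ) : ℤ) - j = (a : ℕ) := by omega
    rw [ha, hsymmZ, if_pos (Int.natCast_nonneg _), Int.toNat_natCast, specializeB_hsymm]
  rcases lt_or_ge N j with hj | hj
  · rw [hZ_neg N hj, hdiffZ, if_neg (by omega), zero_add, map_sum]
    refine Finset.sum_eq_zero fun k _ => ?_
    rw [hZ_neg k (k.isLt.trans hj), mul_zero, map_zero]
  · obtain ⟨n, rfl⟩ := Nat.exists_eq_add_of_le hj
    have hn : ((j + n : ℕ) : ℤ) - j = (n : ℕ) := by omega
    rw [map_add, hZ_add, hn, hdiffZ, if_pos (Int.natCast_nonneg _), Int.toNat_natCast, hdiff,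
      Finset.sum_range_succ', add_comm (hsymmF A n), map_sum]
    congr 1
    · rw [← Equiv.sum_comp Fin.revPerm]
      have hterm : ∀ i : Fin (j + n), specializeB (j + n) m
          ((-1) ^ (j + n - (Fin.rev i : ℕ)) * C (X (Fin.rev (Fin.rev i))) *
            hsymmZ (Fin m) (MvPolynomial (Fin (j + n)) ℂ) (((Fin.rev i : ℕ) : ℤ) - j)) =
          if (i : ℕ) < n then (-1) ^ ((i : ℕ) + 1) * esymmF B ((i : ℕ) + 1) *
            hsymmF A (n - ((i : ℕ) + 1)) else 0 := fun i => by
        have hi := i.isLt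
        split_ifs with hin
        · have h1 : (Fin.rev i : ℕ) = j + (n - ((i : ℕ) + 1)) := by
            rw [Fin.val_rev]; omega
          have h2 : j + n - (Fin.rev i : ℕ) = (i : ℕ) + 1 := by
            rw [Fin.val_rev]; omega
          rw [h2, h1, map_mul, map_mul, hZ_add, Fin.rev_rev, specializeB_C_X, map_pow, map_neg,
            map_one]
        · rw [hZ_neg _ (by rw [Fin.val_rev]; omega), mul_zero, map_zero]
      have hrange : Finset.range (j + n) = Finset.range (n + j) := by rw [add_comm]
      simp only [Fin.revPerm_apply, hterm]
      rw [Fin.sum_univ_eq_sum_range (fun i => if i < n then (-1) ^ (i + 1) * esymmF B (i + 1) *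
        hsymmF A (n - (i + 1)) else 0) (j + n), hrange, Finset.sum_range_add,
        Finset.sum_eq_zero (s := Finset.range j) fun i _ => if_neg (by omega), add_zero]
      exact Finset.sum_congr rfl fun i hi => if_pos (Finset.mem_range.1 hi)
    · have h0 : esymmF B 0 = 1 := by simp [esymmF]
      rw [h0]
      simp

end Specialization

theorem pderiv_of_deformed_potential (N m : ℕ) (hN : 2 ≤ N) (hm : 1 ≤ m)
    (F : MvPolynomial (Fin m) (MvPolynomial (Fin N) ℂ))
    (hF : aeval (fun i : Fin m => esymm (Fin m) (MvPolynomial (Fin N) ℂ) ((i : ℕ) + 1)) F =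
      psum (Fin m) (MvPolynomial (Fin N) ℂ) (N + 1) +
        ∑ k : Fin N,
          (-1 : MvPolynomial (Fin m) (MvPolynomial (Fin N) ℂ)) ^ (N - (k : ℕ)) *
            (((N + 1 : ℂ) / ((k : ℕ) + 1 : ℂ)) •
              (C (X (Fin.rev k)) * psum (Fin m) (MvPolynomial (Fin N) ℂ) ((k : ℕ) + 1))))
    (j : Fin m) :
    aeval (fun i : Fin m => esymm (Fin m) (MvPolynomial (Fin N) ℂ) ((i : ℕ) + 1)) (pderiv j F) =
      (-1 : MvPolynomial (Fin m) (MvPolynomial (Fin N) ℂ)) ^ (j : ℕ) * ((N : _) + 1) *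
        (hsymmZ (Fin m) (MvPolynomial (Fin N) ℂ) ((N : ℤ) - (j : ℕ)) +
          ∑ k : Fin N,
            (-1 : MvPolynomial (Fin m) (MvPolynomial (Fin N) ℂ)) ^ (N - (k : ℕ)) *
              C (X (Fin.rev k)) *
                hsymmZ (Fin m) (MvPolynomial (Fin N) ℂ) (((k : ℕ) : ℤ) - ((j : ℕ) : ℤ))) ∧
    eval₂Hom
        ((aeval (fun t : Fin N =>
            esymmF (Finset.univ.image (Sum.inr : Fin N → Fin m ⊕ Fin N)) ((t : ℕ) + 1))) :
          MvPolynomial (Fin N) ℂ →ₐ[ℂ] MvPolynomial (Fin m ⊕ Fin N) ℂ).toRingHom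
        (fun i : Fin m => X (Sum.inl i))
        (aeval (fun i : Fin m => esymm (Fin m) (MvPolynomial (Fin N) ℂ) ((i : ℕ) + 1))
          (pderiv j F)) =
      (-1 : MvPolynomial (Fin m ⊕ Fin N) ℂ) ^ (j : ℕ) * ((N : _) + 1) *
        hdiffZ (Finset.univ.image (Sum.inl : Fin m → Fin m ⊕ Fin N))
          (Finset.univ.image (Sum.inr : Fin N → Fin m ⊕ Fin N)) ((N : ℤ) - (j : ℕ)) := by
  have hfst : (fun i : Fin m => aeval (fun i : Fin m =>
      esymm (Fin m) (MvPolynomial (Fin N) ℂ) ((i : ℕ) + 1)) (pderiv i F)) =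
      fun i : Fin m =>
        (-1 : MvPolynomial (Fin m) (MvPolynomial (Fin N) ℂ)) ^ (i : ℕ) * ((N : _) + 1) *
        (hsymmZ (Fin m) (MvPolynomial (Fin N) ℂ) ((N : ℤ) - (i : ℕ)) +
          ∑ k : Fin N,
            (-1 : MvPolynomial (Fin m) (MvPolynomial (Fin N) ℂ)) ^ (N - (k : ℕ)) *
              C (X (Fin.rev k)) *
                hsymmZ (Fin m) (MvPolynomial (Fin N) ℂ) (((k : ℕ) : ℤ) - ((i : ℕ) : ℤ))) := by
    refine eq_of_sum_mul_esymmOn_erase_eq fun l => ?_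
    have hl := congrArg (pderiv l) hF
    rw [pderiv_aeval] at hl
    simp only [pderiv_esymm_succ] at hl
    rw [hl, sum_hsymmZ_add_sum_mul_esymmOn_erase, map_add, map_sum, pderiv_psum_succ]
    congr 1
    exact Finset.sum_congr rfl fun k _ => pderiv_smul_C_mul_psum l _ _ _
  have hj := congrFun hfst j
  refine ⟨hj, ?_⟩
  have hs := congrArg (specializeB N m) hj
  rw [map_mul, specializeB_hsymmZ_add_sum] at hs
  simp only [map_mul, map_pow, map_neg, map_one, map_add, map_natCast] at hs
  exact hs
end

section
/- Let 1 ≤ m ≤ N be integers. Then h_N(X), h_{N−1}(X), …, h_{N+1−m}(X) is a regular sequence in the ring of symmetric polynomials in m variables x_1,…,x_m over ℂ (equivalently, in ℂ[x_1,…,x_m]^{S_m}). -/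
/-!
Statement 7: For `1 ≤ m ≤ N`, the sequence `h_N(X), h_{N−1}(X), …, h_{N+1−m}(X)` is a
regular sequence in the ring `ℂ[x_1,…,x_m]^{S_m}` of symmetric polynomials in `m` variables:
the ideal it generates is proper, and each term is a non-zero-divisor modulo its predecessors.
-/

open MvPolynomial

theorem mem_of_C_mul_mem {R : Type*} [CommRing R] {I : Ideal R} {p : Polynomial R}
    (hp : p.Monic) {a : R} (ha : ∀ x, a * x ∈ I → x ∈ I) (g : Polynomial R)
    (hg : Polynomial.C a * g ∈ I.map Polynomial.C ⊔ Ideal.span {p}) :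
    g ∈ I.map Polynomial.C ⊔ Ideal.span {p} := by
  obtain ⟨u, hu, v, hv, huv⟩ := Submodule.mem_sup.1 hg
  obtain ⟨q, rfl⟩ := Ideal.mem_span_singleton.1 hv
  have hmod : a • (g %ₘ p) = u %ₘ p := by
    rw [← Polynomial.smul_modByMonic, Polynomial.smul_eq_C_mul, ← huv, Polynomial.add_modByMonic,
      (Polynomial.modByMonic_eq_zero_iff_dvd hp).2 (dvd_mul_right p q), add_zero]
  have hu0 : u.map (Ideal.Quotient.mk I) = 0 := by
    ext n
    simpa [Ideal.Quotient.eq_zero_iff_mem] using Ideal.mem_map_C_iff.1 hu n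
  have hr : g %ₘ p ∈ I.map Polynomial.C := by
    refine Ideal.mem_map_C_iff.2 fun n => ha _ ?_
    rw [← smul_eq_mul, ← Polynomial.coeff_smul, hmod, ← Ideal.Quotient.eq_zero_iff_mem,
      ← Polynomial.coeff_map, Polynomial.map_modByMonic _ hp, hu0, Polynomial.zero_modByMonic,
      Polynomial.coeff_zero]
  rw [← Polynomial.modByMonic_add_div g p]
  exact add_mem (Ideal.mem_sup_left hr)
    (Ideal.mem_sup_right (Ideal.mem_span_singleton.2 (dvd_mul_right _ _)))

theorem hsymm_option_succ {σ : Type*} [Fintype σ] [DecidableEq σ] (R : Type*) [CommRing R]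
    (n : ℕ) :
    hsymm (Option σ) R (n + 1) =
      X none * hsymm (Option σ) R n + rename some (hsymm σ R (n + 1)) := by
  have h : hsymm (Option σ) R (n + 1) = ∑ s : Sym (Option σ) n ⊕ Sym σ (n + 1),
      (((SymOptionSuccEquiv.decode s : Sym (Option σ) (n + 1)) :
        Multiset (Option σ)).map X).prod :=
    (symOptionSuccEquiv.symm.sum_comp _).symm
  rw [h, Fintype.sum_sum_type, hsymm, hsymm, Finset.mul_sum, map_sum]
  congr 1
  · refine Finset.sum_congr rfl fun s _ => ?_
    rw [SymOptionSuccEquiv.decode_inl, Sym.coe_cons, Multiset.map_cons, Multiset.prod_cons]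
    rfl
  · refine Finset.sum_congr rfl fun s _ => ?_
    rw [SymOptionSuccEquiv.decode_inr, Sym.coe_map, map_multiset_prod, Multiset.map_map,
      Multiset.map_map]
    congr 1
    exact Multiset.map_congr rfl fun i _ => (rename_X _ _).symm

theorem hsymm_fin_succ (R : Type*) [CommRing R] (m n : ℕ) :
    hsymm (Fin (m + 1)) R (n + 1) =
      X 0 * hsymm (Fin (m + 1)) R n + rename Fin.succ (hsymm (Fin m) R (n + 1)) := by
  have h := congrArg (rename (_root_.finSuccEquiv m).symm) (hsymm_option_succ (σ := Fin m) R n)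
  rwa [map_add, map_mul, rename_hsymm, rename_hsymm, rename_X, rename_rename,
    finSuccEquiv_symm_none,
    show (_root_.finSuccEquiv m).symm ∘ some = Fin.succ from funext finSuccEquiv_symm_some] at h

theorem finSuccEquiv_rename_succ (R : Type*) [CommRing R] (m : ℕ) (f : MvPolynomial (Fin m) R) :
    MvPolynomial.finSuccEquiv R m (rename Fin.succ f) = Polynomial.C f := by
  induction f using MvPolynomial.induction_on with
  | C a => simp [← finSuccEquiv_comp_C_eq_C]
  | add p q hp hq => simp [hp, hq]
  | mul_X p i hp => simp [hp, finSuccEquiv_X_succ]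

theorem monic_finSuccEquiv_hsymm (R : Type*) [CommRing R] [Nontrivial R] (m n : ℕ) :
    (MvPolynomial.finSuccEquiv R m (hsymm (Fin (m + 1)) R n)).Monic := by
  induction n with
  | zero => simp
  | succ n hp =>
    rw [hsymm_fin_succ, map_add, map_mul, finSuccEquiv_X_zero, finSuccEquiv_rename_succ]
    refine (Polynomial.monic_X.mul hp).add_of_left ?_
    refine Polynomial.degree_C_le.trans_lt (Polynomial.natDegree_pos_iff_degree_pos.1 ?_)
    rw [Polynomial.monic_X.natDegree_mul hp, Polynomial.natDegree_X]
    omega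

/-- The ideal generated by `h_N, h_{N-1}, …, h_{N-k+1}` in `m` variables. -/
noncomputable def hsymmIdeal (R : Type*) [CommRing R] (m N k : ℕ) :
    Ideal (MvPolynomial (Fin m) R) :=
  Ideal.span ((fun i => hsymm (Fin m) R (N - i)) '' Set.Iio k)

theorem hsymm_mem_hsymmIdeal (R : Type*) [CommRing R] (m N : ℕ) {i k : ℕ} (h : i < k) :
    hsymm (Fin m) R (N - i) ∈ hsymmIdeal R m N k :=
  Ideal.subset_span ⟨i, h, rfl⟩

theorem hsymmIdeal_succ_succ (R : Type*) [CommRing R] (m N k : ℕ) (hk : k ≤ N) :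
    hsymmIdeal R (m + 1) N (k + 1) =
      (hsymmIdeal R m N k).map
          (rename Fin.succ : _ →ₐ[R] MvPolynomial (Fin (m + 1)) R).toRingHom ⊔
        Ideal.span {hsymm (Fin (m + 1)) R (N - k)} := by
  apply le_antisymm
  · have key : ∀ j ≤ k, hsymm (Fin (m + 1)) R (N - (k - j)) ∈
        (hsymmIdeal R m N k).map
            (rename Fin.succ : _ →ₐ[R] MvPolynomial (Fin (m + 1)) R).toRingHom ⊔
          Ideal.span {hsymm (Fin (m + 1)) R (N - k)} := by
      intro j
      induction j with
      | zero => exact fun _ => Ideal.mem_sup_right (Ideal.mem_span_singleton_self _)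
      | succ j ih =>
        intro hj
        have hmem := Ideal.mem_map_of_mem
          (rename Fin.succ : _ →ₐ[R] MvPolynomial (Fin (m + 1)) R).toRingHom
          (hsymm_mem_hsymmIdeal R m N (show k - (j + 1) < k by omega))
        rw [show N - (k - (j + 1)) = N - (k - j) + 1 by omega] at hmem ⊢
        rw [hsymm_fin_succ]
        exact add_mem (Ideal.mul_mem_left _ _ (ih (by omega))) (Ideal.mem_sup_left hmem)
    refine Ideal.span_le.2 ?_
    rintro _ ⟨i, hi, rfl⟩
    have hik : i ≤ k := Nat.lt_succ_iff.1 hi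
    simpa [Nat.sub_sub_self hik] using key (k - i) (Nat.sub_le _ _)
  · refine sup_le ?_ ((Ideal.span_singleton_le_iff_mem _).2
      (hsymm_mem_hsymmIdeal R (m + 1) N k.lt_succ_self))
    refine Ideal.map_le_iff_le_comap.2 (Ideal.span_le.2 ?_)
    rintro _ ⟨i, hi, rfl⟩
    have hik : i < k := hi
    have h₁ := hsymm_mem_hsymmIdeal R (m + 1) N (show i < k + 1 by omega)
    have h₂ := hsymm_mem_hsymmIdeal R (m + 1) N (show i + 1 < k + 1 by omega)
    change rename Fin.succ (hsymm (Fin m) R (N - i)) ∈ hsymmIdeal R (m + 1) N (k + 1)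
    rw [show N - i = N - (i + 1) + 1 by omega] at h₁ ⊢
    rw [← add_sub_cancel_left (X 0 * hsymm (Fin (m + 1)) R (N - (i + 1)))
      (rename Fin.succ _), ← hsymm_fin_succ]
    exact sub_mem h₁ (Ideal.mul_mem_left _ _ h₂)

theorem mem_hsymmIdeal_succ_succ_iff (R : Type*) [CommRing R] {m N k : ℕ} (hk : k ≤ N)
    (f : MvPolynomial (Fin (m + 1)) R) :
    f ∈ hsymmIdeal R (m + 1) N (k + 1) ↔
      MvPolynomial.finSuccEquiv R m f ∈ (hsymmIdeal R m N k).map Polynomial.C ⊔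
        Ideal.span {MvPolynomial.finSuccEquiv R m (hsymm (Fin (m + 1)) R (N - k))} := by
  have hcomp : (MvPolynomial.finSuccEquiv R m).toRingEquiv.toRingHom.comp
      (rename Fin.succ : _ →ₐ[R] MvPolynomial (Fin (m + 1)) R).toRingHom = Polynomial.C :=
    RingHom.ext (finSuccEquiv_rename_succ R m)
  have hmap : (hsymmIdeal R (m + 1) N (k + 1)).map
      (MvPolynomial.finSuccEquiv R m).toRingEquiv.toRingHom =
      (hsymmIdeal R m N k).map Polynomial.C ⊔
        Ideal.span {MvPolynomial.finSuccEquiv R m (hsymm (Fin (m + 1)) R (N - k))} := by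
    rw [hsymmIdeal_succ_succ R m N k hk, Ideal.map_sup, Ideal.map_span, Set.image_singleton,
      ← hcomp, ← Ideal.map_map]
    rfl
  rw [← hmap]
  refine Iff.trans ?_ (Ideal.mem_map_of_equiv (MvPolynomial.finSuccEquiv R m).toRingEquiv _).symm
  exact ⟨fun h => ⟨f, h, rfl⟩, fun ⟨x, hx, h⟩ => (MvPolynomial.finSuccEquiv R m).injective h ▸ hx⟩

theorem mem_hsymmIdeal_of_hsymm_mul_mem (R : Type*) [CommRing R] [IsDomain R] {m N k : ℕ}
    (hkm : k < m) (hkN : k ≤ N) (f : MvPolynomial (Fin m) R)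
    (hf : hsymm (Fin m) R (N - k) * f ∈ hsymmIdeal R m N k) : f ∈ hsymmIdeal R m N k := by
  induction k generalizing m with
  | zero =>
    obtain ⟨m, rfl⟩ := Nat.exists_eq_add_one.2 hkm
    have hne : hsymm (Fin (m + 1)) R N ≠ 0 := fun h =>
      (monic_finSuccEquiv_hsymm R m N).ne_zero (by rw [h, map_zero])
    simpa [hsymmIdeal, hne] using hf
  | succ k ih =>
    obtain ⟨m, rfl⟩ := Nat.exists_eq_add_one.2 (Nat.zero_lt_of_lt hkm)
    rw [mem_hsymmIdeal_succ_succ_iff R (by omega)]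
    refine mem_of_C_mul_mem (monic_finSuccEquiv_hsymm R m (N - k))
      (fun g => ih (by omega) (by omega) g) _ ?_
    rw [← finSuccEquiv_rename_succ, ← map_mul, ← mem_hsymmIdeal_succ_succ_iff R (by omega)]
    have h := hsymm_fin_succ R m (N - (k + 1))
    rw [show N - (k + 1) + 1 = N - k by omega] at h
    rw [← add_sub_cancel_left (X 0 * hsymm (Fin (m + 1)) R (N - (k + 1))) (rename Fin.succ _), ← h,
      sub_mul, mul_assoc]
    exact sub_mem (Ideal.mul_mem_right _ _ (hsymm_mem_hsymmIdeal R (m + 1) N k.lt_succ_self))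
      (Ideal.mul_mem_left _ _ hf)

theorem comap_map_of_retraction {A B : Type*} [CommRing A] [CommRing B] [Algebra A B]
    (ρ : B →ₗ[A] A) (hρ : ρ 1 = 1) (I : Ideal A) :
    (I.map (algebraMap A B)).comap (algebraMap A B) = I := by
  refine le_antisymm (fun x hx => ?_) Ideal.le_comap_map
  have key : ∀ y ∈ I.map (algebraMap A B), ∀ b, ρ (b * y) ∈ I := by
    intro y hy
    induction hy using Submodule.span_induction with
    | mem y hy =>
      obtain ⟨a, ha, rfl⟩ := hy
      intro b
      rw [mul_comm, ← Algebra.smul_def, map_smul, smul_eq_mul]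
      exact I.mul_mem_right _ ha
    | zero => simp
    | add y z _ _ hy hz => exact fun b => by simpa [mul_add] using add_mem (hy b) (hz b)
    | smul c y _ hy => exact fun b => by simpa [mul_assoc] using hy (b * c)
  simpa [hρ, Algebra.algebraMap_eq_smul_one] using key _ hx 1

/-- The Reynolds operator, averaging a polynomial over all permutations of the variables. -/
noncomputable def symmetrization (σ K : Type*) [Fintype σ] [DecidableEq σ] [Field K] :
    MvPolynomial σ K →ₗ[symmetricSubalgebra σ K] symmetricSubalgebra σ K where
  toFun f := ⟨(Fintype.card (Equiv.Perm σ) : K)⁻¹ • ∑ e : Equiv.Perm σ, rename e f, by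
    refine Subalgebra.smul_mem _ (fun e => ?_) _
    simp only [map_sum, rename_rename]
    exact Equiv.sum_comp (Equiv.mulLeft e) fun e' : Equiv.Perm σ => rename e' f⟩
  map_add' f g := by
    ext1
    simp [Finset.sum_add_distrib]
  map_smul' a f := by
    ext1
    have ha : ∀ e : Equiv.Perm σ, rename e (a : MvPolynomial σ K) = a := a.2
    simp [Subalgebra.smul_def, ha, ← Finset.mul_sum]

theorem symmetrization_one (σ K : Type*) [Fintype σ] [DecidableEq σ] [Field K] [CharZero K] :
    symmetrization σ K 1 = 1 := by
  ext1
  have h : (Fintype.card (Equiv.Perm σ) : K) ≠ 0 := Nat.cast_ne_zero.2 Fintype.card_ne_zero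
  simp only [symmetrization, LinearMap.coe_mk, AddHom.coe_mk, map_one, Finset.sum_const,
    Finset.card_univ, OneMemClass.coe_one]
  rw [← Nat.cast_smul_eq_nsmul K, inv_smul_smul₀ h]

theorem constantCoeff_hsymm (σ R : Type*) [Fintype σ] [DecidableEq σ] [CommRing R] {n : ℕ}
    (hn : n ≠ 0) : constantCoeff (hsymm σ R n) = 0 := by
  rw [hsymm, map_sum]
  refine Finset.sum_eq_zero fun s _ => ?_
  obtain ⟨a, ha⟩ := Multiset.card_pos_iff_exists_mem.1 (s.2.symm ▸ Nat.pos_of_ne_zero hn)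
  rw [map_multiset_prod, Multiset.map_map]
  exact Multiset.prod_eq_zero (Multiset.mem_map.2 ⟨a, ha, constantCoeff_X R a⟩)

theorem hsymm_regular_sequence (m N : ℕ) (hm : 1 ≤ m) (hmN : m ≤ N) :
    ∃ r : Fin m → ↥(symmetricSubalgebra (Fin m) ℂ),
      (∀ i : Fin m, ((r i : MvPolynomial (Fin m) ℂ)) =
          hsymmF (Finset.univ : Finset (Fin m)) (N - (i : ℕ))) ∧
      Ideal.span (Set.range r) ≠ ⊤ ∧
      ∀ i : Fin m, ∀ x : ↥(symmetricSubalgebra (Fin m) ℂ),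
        r i * x ∈ Ideal.span (r '' {j : Fin m | j < i}) →
          x ∈ Ideal.span (r '' {j : Fin m | j < i}) := by
  let r : Fin m → symmetricSubalgebra (Fin m) ℂ := fun i =>
    ⟨hsymm (Fin m) ℂ (N - i), hsymm_isSymmetric _ _ _⟩
  have hmap (i : Fin m) : (Ideal.span (r '' {j : Fin m | j < i})).map
      (algebraMap _ (MvPolynomial (Fin m) ℂ)) = hsymmIdeal ℂ m N i := by
    rw [Ideal.map_span, hsymmIdeal, Set.image_image]
    congr 1
    ext f
    constructor
    · rintro ⟨j, hj, rfl⟩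
      exact ⟨j, hj, rfl⟩
    · rintro ⟨j, hj, rfl⟩
      exact ⟨⟨j, lt_trans hj i.2⟩, hj, rfl⟩
  refine ⟨r, fun i => ?_, ?_, fun i x hx => ?_⟩
  · simp [r, hsymmF, hsymm, Finset.sym_univ]
  · have hle : Ideal.span (Set.range r) ≤ RingHom.ker
        ((constantCoeff : MvPolynomial (Fin m) ℂ →+* ℂ).comp (algebraMap _ _)) := by
      refine Ideal.span_le.2 ?_
      rintro _ ⟨i, rfl⟩
      exact constantCoeff_hsymm _ _ (by omega)
    exact fun h => RingHom.ker_ne_top _ (top_le_iff.1 (h ▸ hle))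
  · rw [← comap_map_of_retraction _ (symmetrization_one (Fin m) ℂ) (Ideal.span _), Ideal.mem_comap,
      hmap] at hx ⊢
    exact mem_hsymmIdeal_of_hsymm_mul_mem ℂ i.2 (by omega) _ hx
end

section
/- Let N ≥ 2 and k, l ≥ 1 be integers, and let i_1,…,i_k and j_1,…,j_l be positive integers with i_1+…+i_k = j_1+…+j_l = m. Let X_1,…,X_k, Y_1,…,Y_l be pairwise disjoint alphabets with |X_α| = i_α and |Y_β| = j_β, and set X := X_1∪…∪X_k, Y := Y_1∪…∪Y_l. Let R := Sym(X_1|…|X_k|Y_1|…|Y_l) be the subring of ℂ[X∪Y] consisting of polynomials symmetric separately in each X_α and in each Y_β, and let R̃ := R ⊗_ℂ ℂ[B_1,…,B_N]. Then the sequence e_1(X)−e_1(Y), e_2(X)−e_2(Y), …, e_m(X)−e_m(Y) is a regular sequence in R̃. -/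
/-!
Statement 8: Let `i_1+…+i_k = j_1+…+j_l = m`, let `X_1,…,X_k, Y_1,…,Y_l` be pairwise disjoint
alphabets with `|X_α| = i_α`, `|Y_β| = j_β`, and let
`R̃ = Sym(X_1|…|X_k|Y_1|…|Y_l) ⊗ ℂ[B_1,…,B_N]` (realized as the subalgebra of
`ℂ[X∪Y∪{B}]` of polynomials symmetric separately in each block `X_α` and each block `Y_β`).
Then `e_1(X)−e_1(Y), …, e_m(X)−e_m(Y)` is a regular sequence in `R̃`.
-/

open MvPolynomial

variable (N k l : ℕ) (iv : Fin k → ℕ) (jv : Fin l → ℕ)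

/-- The ambient variable set: the blocks `X_α`, the blocks `Y_β`, and `B_1,…,B_N`. -/
abbrev ambient : Type :=
  ((Σ α : Fin k, Fin (iv α)) ⊕ (Σ β : Fin l, Fin (jv β))) ⊕ Fin N

/-- `Sym(X_1|…|X_k|Y_1|…|Y_l) ⊗ ℂ[B_1,…,B_N]`: the subalgebra of polynomials invariant
under all permutations of the variables preserving each block `X_α` and each `Y_β`
(and fixing the `B`'s). -/
noncomputable def Rtil : Subalgebra ℂ (MvPolynomial (ambient N k l iv jv) ℂ) where
  carrier := {p | ∀ (e : ∀ α : Fin k, Equiv.Perm (Fin (iv α)))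
      (f : ∀ β : Fin l, Equiv.Perm (Fin (jv β))),
      rename (Equiv.sumCongr
        (Equiv.sumCongr (Equiv.sigmaCongrRight e) (Equiv.sigmaCongrRight f))
        (Equiv.refl (Fin N))) p = p}
  mul_mem' {a b} ha hb := fun e f => by rw [map_mul, ha e f, hb e f]
  add_mem' {a b} ha hb := fun e f => by rw [map_add, ha e f, hb e f]
  algebraMap_mem' r := fun e f => by
    rw [MvPolynomial.algebraMap_eq, rename_C]

/-- The finset of all `X`-variables. -/
noncomputable def XSet : Finset (ambient N k l iv jv) :=
  Finset.univ.image fun p : Σ α : Fin k, Fin (iv α) => Sum.inl (Sum.inl p)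

/-- The finset of all `Y`-variables. -/
noncomputable def YSet : Finset (ambient N k l iv jv) :=
  Finset.univ.image fun p : Σ β : Fin l, Fin (jv β) => Sum.inl (Sum.inr p)

open scoped TensorProduct

theorem Multiset.esymm_cons_succ {R : Type*} [CommSemiring R] (a : R) (s : Multiset R) (n : ℕ) :
    (a ::ₘ s).esymm (n + 1) = s.esymm (n + 1) + a * s.esymm n := by
  simp [Multiset.esymm, Multiset.powersetCard_cons, Multiset.sum_map_mul_left]

theorem MvPolynomial.optionEquivRight_esymm_succ (σ Q : Type*) [Fintype σ] [CommRing Q] (n : ℕ) :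
    optionEquivRight Q σ (esymm (Option σ) Q (n + 1)) =
      esymm σ (Polynomial Q) (n + 1) + C Polynomial.X * esymm σ (Polynomial Q) n := by
  have h : optionEquivRight Q σ (esymm (Option σ) Q (n + 1)) =
      aeval (fun o : Option σ => o.elim (C Polynomial.X) X) (esymm (Option σ) Q (n + 1)) := rfl
  have hu : (Finset.univ : Finset (Option σ)).val = none ::ₘ Finset.univ.val.map some := rfl
  rw [h, aeval_esymm_eq_multiset_esymm, hu, esymm_eq_multiset_esymm]
  simp [Multiset.esymm_cons_succ, Function.comp_def]

/-- Each of `r 0, …, r (n - 1)` is a non-zero-divisor modulo its predecessors. -/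
def IsRegularUpTo {A : Type*} [CommRing A] (r : ℕ → A) (n : ℕ) : Prop :=
  ∀ t < n, ∀ x, r t * x ∈ Ideal.span (r '' Set.Iio t) → x ∈ Ideal.span (r '' Set.Iio t)

theorem RingEquiv.mem_span_image_iff {A B : Type*} [CommRing A] [CommRing B] (e : A ≃+* B)
    (s : Set A) (x : A) : e x ∈ Ideal.span (e '' s) ↔ x ∈ Ideal.span s := by
  have h : Ideal.span (e '' s) = (Ideal.span s).map e := (Ideal.map_span e s).symm
  rw [h, Ideal.mem_map_of_equiv]
  simp

theorem IsRegularUpTo.of_ringEquiv {A B : Type*} [CommRing A] [CommRing B] (e : A ≃+* B)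
    {r : ℕ → A} {n : ℕ} (h : IsRegularUpTo (e ∘ r) n) : IsRegularUpTo r n := by
  intro t ht x hx
  have := h t ht (e x)
  rw [Set.image_comp, e.mem_span_image_iff, Function.comp_apply, ← map_mul,
    e.mem_span_image_iff] at this
  exact this hx

theorem Module.Flat.quotient_span_of_algEquiv {Q A B : Type*} [CommRing Q] [CommRing A]
    [CommRing B] [Algebra Q A] [Algebra Q B] (e : A ≃ₐ[Q] B) (s : Set A)
    [Module.Flat Q (B ⧸ Ideal.span (e '' s))] : Module.Flat Q (A ⧸ Ideal.span s) :=
  .of_linearEquiv (Ideal.quotientEquivAlg (Ideal.span s) (Ideal.span (e '' s)) e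
    (Ideal.map_span e s).symm).toLinearEquiv

/-- A unitriangular change of generators does not affect the ideals generated by the initial
segments of a sequence. -/
theorem Ideal.span_image_Iio_eq_of_succ_eq {A : Type*} [CommRing A] {r r' : ℕ → A} (z : A)
    (h0 : r 0 = r' 0) (hs : ∀ t, r (t + 1) = r' (t + 1) + z * r' t) (t : ℕ) :
    Ideal.span (r '' Set.Iio t) = Ideal.span (r' '' Set.Iio t) := by
  have key : ∀ t, (∀ u < t, r u ∈ Ideal.span (r' '' Set.Iio t)) ∧
      ∀ u < t, r' u ∈ Ideal.span (r '' Set.Iio t) := by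
    have mem : ∀ (q : ℕ → A) {u t}, u < t → q u ∈ Ideal.span (q '' Set.Iio t) :=
      fun q u t hu => Ideal.subset_span ⟨u, hu, rfl⟩
    refine fun t => ⟨?_, fun u => ?_⟩
    · rintro (_ | u) hu
      · exact h0 ▸ mem r' hu
      · rw [hs]
        exact add_mem (mem r' hu) (Ideal.mul_mem_left _ _ (mem r' (by omega)))
    · induction u with
      | zero => exact fun hu => h0 ▸ mem r hu
      | succ u ih =>
        intro hu
        rw [eq_sub_of_add_eq (hs u).symm]
        exact sub_mem (mem r hu) (Ideal.mul_mem_left _ _ (ih (by omega)))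
  apply le_antisymm <;> rw [Ideal.span_le] <;> rintro _ ⟨u, hu, rfl⟩
  exacts [(key t).1 u hu, (key t).2 u hu]

theorem IsRegularUpTo.of_succ_eq {A : Type*} [CommRing A] {r r' : ℕ → A} (z : A)
    (h0 : r 0 = r' 0) (hs : ∀ t, r (t + 1) = r' (t + 1) + z * r' t) {n : ℕ}
    (h : IsRegularUpTo r' n) : IsRegularUpTo r n := by
  intro t ht x hx
  rw [Ideal.span_image_Iio_eq_of_succ_eq z h0 hs] at hx ⊢
  refine h t ht x ?_
  rcases t with _ | t
  · rwa [← h0]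
  · rw [eq_sub_of_add_eq (hs t).symm, sub_mul]
    exact sub_mem hx (Ideal.mul_mem_right _ _
      (Ideal.mul_mem_left _ _ (Ideal.subset_span ⟨t, t.lt_succ_self, rfl⟩)))

theorem Module.Flat.quotient_sup_span_of_monic {Q A : Type*} [CommRing Q] [CommRing A]
    [Algebra Q A] [Algebra (Polynomial Q) A] [IsScalarTower Q (Polynomial Q) A] (I : Ideal A)
    [Module.Flat (Polynomial Q) (A ⧸ I)] {d : Polynomial Q} (hd : d.Monic) :
    Module.Flat Q (A ⧸ I ⊔ Ideal.span {algebraMap (Polynomial Q) A d}) := by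
  have := hd.free_quotient
  have : Module.Flat Q ((Polynomial Q ⧸ Ideal.span {d}) ⊗[Polynomial Q] (A ⧸ I)) :=
    .trans Q (Polynomial Q ⧸ Ideal.span {d}) _
  have hmap : (Ideal.span {algebraMap (Polynomial Q) A d}).map (Ideal.Quotient.mkₐ Q I) =
      (Ideal.span {d}).map (algebraMap (Polynomial Q) (A ⧸ I)) := by
    simp only [Ideal.map_span, Set.image_singleton]
    rfl
  have e := (((Algebra.TensorProduct.quotIdealMapEquivQuotTensor (A ⧸ I)
    (Ideal.span {d})).toLinearEquiv.restrictScalars (Polynomial Q)).restrictScalars Q)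
  have : Module.Flat Q ((A ⧸ I) ⧸ (Ideal.span {algebraMap (Polynomial Q) A d}).map
      (Ideal.Quotient.mkₐ Q I)) := by
    rw [hmap]
    exact .of_linearEquiv e
  exact .of_linearEquiv (DoubleQuot.quotQuotEquivQuotSupₐ Q I _).toLinearEquiv.symm

/-- If `c 0, c 1, …` are the values of `e₁, e₂, …` on a multiset containing the element `X`, then
`divCoeff c 0, divCoeff c 1, …` are their values on the multiset with one copy of `X` removed. -/
noncomputable def divCoeff {Q : Type*} [CommRing Q] (c : ℕ → Q) : ℕ → Polynomial Q
  | 0 => Polynomial.C (c 0) - Polynomial.X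
  | t + 1 => Polynomial.C (c (t + 1)) - Polynomial.X * divCoeff c t

theorem exists_monic_divCoeff_eq {Q : Type*} [CommRing Q] (c : ℕ → Q) (t : ℕ) :
    ∃ d : Polynomial Q, d.Monic ∧ divCoeff c t = (-1) ^ (t + 1) * d := by
  suffices ∃ p : Polynomial Q, (∀ m, t + 1 ≤ m → p.coeff m = 0) ∧
      divCoeff c t = (-1) ^ (t + 1) * (Polynomial.X ^ (t + 1) + p) by
    obtain ⟨p, hp, h⟩ := this
    exact ⟨_, Polynomial.monic_X_pow_add
      ((Polynomial.degree_lt_iff_coeff_zero p (t + 1)).2 hp), h⟩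
  induction t with
  | zero =>
    refine ⟨-Polynomial.C (c 0), fun m hm => ?_, by simp [divCoeff, sub_eq_add_neg]⟩
    rw [Polynomial.coeff_neg, Polynomial.coeff_C_of_ne_zero (by omega), neg_zero]
  | succ t ih =>
    obtain ⟨p, hp, h⟩ := ih
    refine ⟨Polynomial.X * p + Polynomial.C ((-1) ^ t * c (t + 1)), fun m hm => ?_, ?_⟩
    · obtain ⟨m, rfl⟩ : ∃ k, m = k + 1 := ⟨m - 1, by omega⟩
      rw [Polynomial.coeff_add, Polynomial.coeff_X_mul, hp m (by omega),
        Polynomial.coeff_C_of_ne_zero (by omega), add_zero]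
    · have h1 : ((-1 : Polynomial Q) ^ t) * (-1) ^ t = 1 := by
        rw [← mul_pow]; simp
      rw [divCoeff, h]
      simp only [map_mul, map_pow, map_neg, map_one]
      linear_combination (-Polynomial.C (c (t + 1))) * h1

theorem IsRegularUpTo.succ_of_flat {Q A : Type*} [CommRing Q] [CommRing A] [Algebra Q A]
    {r : ℕ → A} {n : ℕ} (h : IsRegularUpTo r n)
    [Module.Flat Q (A ⧸ Ideal.span (r '' Set.Iio n))] {d : Q} (hd : d ∈ nonZeroDivisors Q)
    {u : A} (hu : IsUnit u) (hr : r n = u * algebraMap Q A d) : IsRegularUpTo r (n + 1) := by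
  intro t ht x hx
  obtain ht | rfl := Nat.lt_succ_iff_lt_or_eq.1 ht
  · exact h t ht x hx
  rw [hr, mul_assoc, Ideal.unit_mul_mem_iff_mem _ hu, ← Algebra.smul_def] at hx
  rw [← Ideal.Quotient.eq_zero_iff_mem] at hx ⊢
  exact (Module.Flat.isSMulRegular_of_nonZeroDivisors hd).right_eq_zero_of_smul hx

theorem MvPolynomial.isRegularUpTo_esymm_sub_C_and_flat (σ : Type*) [Fintype σ] :
    ∀ (Q : Type*) [CommRing Q] (c : ℕ → Q),
      IsRegularUpTo (fun t => esymm σ Q (t + 1) - C (c t)) (Fintype.card σ) ∧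
      Module.Flat Q (MvPolynomial σ Q ⧸ Ideal.span
        ((fun t => esymm σ Q (t + 1) - C (c t)) '' Set.Iio (Fintype.card σ))) := by
  refine Fintype.induction_empty_option (P := fun σ _ => ∀ (Q : Type _) [CommRing Q] (c : ℕ → Q),
      IsRegularUpTo (fun t => esymm σ Q (t + 1) - C (c t)) (Fintype.card σ) ∧
      Module.Flat Q (MvPolynomial σ Q ⧸ Ideal.span
        ((fun t => esymm σ Q (t + 1) - C (c t)) '' Set.Iio (Fintype.card σ)))) ?_ ?_ ?_ σ
  · intro σ τ _ e ih Q _ c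
    let := Fintype.ofEquiv τ e.symm
    have hr : renameEquiv Q e.symm ∘ (fun t => esymm τ Q (t + 1) - C (c t)) =
        fun t => esymm σ Q (t + 1) - C (c t) := by
      ext1 t
      simp [rename_esymm]
    obtain ⟨h1, h2⟩ := ih Q c
    rw [Fintype.card_congr e] at h1 h2
    rw [← hr] at h1 h2
    rw [Set.image_comp] at h2
    exact ⟨.of_ringEquiv (renameEquiv Q e.symm).toRingEquiv h1,
      .quotient_span_of_algEquiv (renameEquiv Q e.symm) _⟩
  · intro Q _ c
    refine ⟨fun t ht => by simp at ht, ?_⟩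
    have h : Ideal.span ((fun t => esymm PEmpty Q (t + 1) - C (c t)) ''
        Set.Iio (Fintype.card PEmpty)) = ⊥ := by simp
    rw [h]
    exact .of_linearEquiv (AlgEquiv.quotientBot Q (MvPolynomial PEmpty Q)).toLinearEquiv
  · intro σ _ ih Q _ c
    rw [Fintype.card_option]
    set n := Fintype.card σ
    set e := optionEquivRight Q σ
    set r := fun t => esymm (Option σ) Q (t + 1) - C (c t)
    let r' := fun t => esymm σ (Polynomial Q) (t + 1) - C (divCoeff c t)
    have h0 : (e ∘ r) 0 = r' 0 := by
      simp only [e, r, r', Function.comp_apply, map_sub, optionEquivRight_esymm_succ,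
        optionEquivRight_C, divCoeff, esymm_zero]
      ring
    have hs : ∀ t, (e ∘ r) (t + 1) = r' (t + 1) + C Polynomial.X * r' t := by
      intro t
      simp only [e, r, r', Function.comp_apply, map_sub, optionEquivRight_esymm_succ,
        optionEquivRight_C, divCoeff, map_mul]
      ring
    obtain ⟨h1, h2⟩ := ih (Polynomial Q) (divCoeff c)
    obtain ⟨d, hd, hdc⟩ := exists_monic_divCoeff_eq c n
    have hu : IsUnit (C (-(-1) ^ (n + 1)) : MvPolynomial σ (Polynomial Q)) :=
      (isUnit_one.neg.pow (n + 1)).neg.map C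
    have hn : r' n = C (-(-1) ^ (n + 1)) * algebraMap (Polynomial Q) _ d := by
      have : esymm σ (Polynomial Q) (n + 1) = 0 := by
        rw [esymm, Finset.powersetCard_eq_empty.2 (by simp [n]), Finset.sum_empty]
      simp only [r', this, hdc, algebraMap_eq, map_mul, map_neg]
      ring
    have hspan : Ideal.span (r' '' Set.Iio (n + 1)) = Ideal.span (r' '' Set.Iio n) ⊔
        Ideal.span {algebraMap (Polynomial Q) (MvPolynomial σ (Polynomial Q)) d} := by
      have hI : Set.Iio (n + 1) = insert n (Set.Iio n) := by
        ext
        simp only [Set.mem_Iio, Set.mem_insert_iff]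
        omega
      rw [hI, Set.image_insert_eq, Ideal.span_insert, sup_comm, hn, Ideal.span_singleton_mul_left_unit hu]
    have : Module.Flat (Polynomial Q)
      (MvPolynomial σ (Polynomial Q) ⧸ Ideal.span (r' '' Set.Iio n)) := h2
    refine ⟨.of_ringEquiv e.toRingEquiv (.of_succ_eq _ h0 hs
      (h1.succ_of_flat hd.mem_nonZeroDivisors hu hn)), ?_⟩
    have : Module.Flat Q
        (MvPolynomial σ (Polynomial Q) ⧸ Ideal.span (e '' (r '' Set.Iio (n + 1)))) := by
      rw [← Set.image_comp, Ideal.span_image_Iio_eq_of_succ_eq _ h0 hs, hspan]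
      exact .quotient_sup_span_of_monic _ hd
    exact .quotient_span_of_algEquiv e _

/-- If a subring `S` of `A` admits an `S`-linear retraction, then every ideal of `S` is contracted
from `A`. -/
theorem Ideal.mem_span_of_linear_retraction {S A : Type*} [CommRing S] [CommRing A] [Algebra S A]
    (ρ : A →ₗ[S] S) (hρ : ρ 1 = 1) (s : Set S) {x : S}
    (hx : algebraMap S A x ∈ Ideal.span (algebraMap S A '' s)) : x ∈ Ideal.span s := by
  have key : ∀ a ∈ Ideal.span (algebraMap S A '' s), ρ a ∈ Ideal.span s := by
    intro a ha
    induction ha using Submodule.closure_induction with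
    | zero => simp
    | add a b _ _ ha hb => rw [map_add]; exact add_mem ha hb
    | smul_mem a _ h =>
      obtain ⟨y, hy, rfl⟩ := h
      rw [smul_eq_mul, mul_comm, ← Algebra.smul_def, map_smul, smul_eq_mul]
      exact Ideal.mul_mem_right _ _ (Ideal.subset_span hy)
  have := key _ hx
  rwa [Algebra.algebraMap_eq_smul_one, map_smul, hρ, smul_eq_mul, mul_one] at this

/-- The permutation of the ambient variables given by permutations of the blocks. -/
def blockPerm
    (g : (∀ α : Fin k, Equiv.Perm (Fin (iv α))) × (∀ β : Fin l, Equiv.Perm (Fin (jv β)))) :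
    ambient N k l iv jv ≃ ambient N k l iv jv :=
  Equiv.sumCongr (Equiv.sumCongr (Equiv.sigmaCongrRight g.1) (Equiv.sigmaCongrRight g.2))
    (Equiv.refl (Fin N))

theorem mem_Rtil_iff (p : MvPolynomial (ambient N k l iv jv) ℂ) :
    p ∈ Rtil N k l iv jv ↔ ∀ g, rename (blockPerm N k l iv jv g) p = p :=
  ⟨fun h g => h g.1 g.2, fun h e f => h (e, f)⟩

theorem blockPerm_mul (g h) : blockPerm N k l iv jv (g * h) =
    (blockPerm N k l iv jv h).trans (blockPerm N k l iv jv g) := by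
  ext ((⟨a, b⟩ | ⟨a, b⟩) | a) <;> rfl

/-- Averaging over the block permutations. -/
noncomputable def blockAverage :
    MvPolynomial (ambient N k l iv jv) ℂ →ₗ[Rtil N k l iv jv] Rtil N k l iv jv where
  toFun p := ⟨C ((Fintype.card ((∀ α : Fin k, Equiv.Perm (Fin (iv α))) ×
      (∀ β : Fin l, Equiv.Perm (Fin (jv β)))) : ℂ)⁻¹) *
      ∑ g, rename (blockPerm N k l iv jv g) p, by
    rw [mem_Rtil_iff]
    intro h
    rw [map_mul, rename_C, map_sum]
    congr 1
    refine Fintype.sum_equiv (Equiv.mulLeft h) _ _ fun g => ?_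
    rw [rename_rename, Equiv.coe_mulLeft, blockPerm_mul, Equiv.coe_trans]⟩
  map_add' p q := by
    ext1
    simp [Finset.sum_add_distrib, mul_add]
  map_smul' s p := by
    ext1
    have hs : ∀ g, rename (blockPerm N k l iv jv g) (s : MvPolynomial _ ℂ) = s :=
      (mem_Rtil_iff N k l iv jv s).1 s.2
    simp only [Algebra.smul_def, Subalgebra.algebraMap_def, map_mul, hs, ← Finset.mul_sum,
      RingHom.id_apply, Algebra.algebraMap_self, MulMemClass.coe_mul]
    ring

theorem blockAverage_one : blockAverage N k l iv jv 1 = 1 := by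
  ext1
  simp only [blockAverage, LinearMap.coe_mk, AddHom.coe_mk, map_one, Finset.sum_const,
    Finset.card_univ, nsmul_eq_mul, mul_one, OneMemClass.coe_one]
  rw [← map_natCast C, ← map_mul,
    inv_mul_cancel₀ (Nat.cast_ne_zero.2 Fintype.card_ne_zero), map_one]

theorem map_esymmF {σ A : Type*} [DecidableEq σ] [CommRing A] [Algebra ℂ A]
    (φ : MvPolynomial σ ℂ →ₐ[ℂ] A) (s : Finset σ) (n : ℕ) :
    φ (esymmF s n) = (s.val.map fun i => φ (X i)).esymm n := by
  simp [esymmF, Finset.esymm_map_val]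

theorem rename_esymmF {σ : Type*} [DecidableEq σ] (e : σ ≃ σ) (s : Finset σ)
    (h : s.image e = s) (n : ℕ) : rename e (esymmF s n) = esymmF s n := by
  have h' : s.val.map e = s.val := by
    conv_rhs => rw [← h, Finset.image_val_of_injOn e.injective.injOn]
  have := map_esymmF (AlgHom.id ℂ (MvPolynomial σ ℂ)) s n
  rw [AlgHom.id_apply] at this
  rw [map_esymmF, this]
  conv_rhs => rw [← h']
  simp

theorem esymmF_sub_mem_Rtil (n : ℕ) : esymmF (XSet N k l iv jv) n - esymmF (YSet N k l iv jv) n ∈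
    Rtil N k l iv jv := by
  rw [mem_Rtil_iff]
  intro g
  rw [map_sub, rename_esymmF, rename_esymmF]
  · ext x
    simp only [YSet, Finset.mem_image, Finset.mem_univ, true_and, exists_exists_eq_and]
    exact ((Equiv.sigmaCongrRight g.2).surjective.exists
      (p := fun a => Sum.inl (Sum.inr a) = x)).symm
  · ext x
    simp only [XSet, Finset.mem_image, Finset.mem_univ, true_and, exists_exists_eq_and]
    exact ((Equiv.sigmaCongrRight g.1).surjective.exists
      (p := fun a => Sum.inl (Sum.inl a) = x)).symm

theorem constantCoeff_esymmF_succ {σ : Type*} [DecidableEq σ] (s : Finset σ) (n : ℕ) :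
    constantCoeff (esymmF s (n + 1)) = 0 := by
  rw [esymmF, map_sum]
  refine Finset.sum_eq_zero fun t ht => ?_
  have : t.card = n + 1 := (Finset.mem_powersetCard.1 ht).2
  simp [Finset.prod_const, this]

/-- Regard the variables of the `X` blocks as the polynomial variables, all others as
coefficients. -/
noncomputable def ambientEquiv : MvPolynomial (ambient N k l iv jv) ℂ ≃ₐ[ℂ]
    MvPolynomial (Σ α : Fin k, Fin (iv α)) (MvPolynomial ((Σ β : Fin l, Fin (jv β)) ⊕ Fin N) ℂ) :=
  (renameEquiv ℂ (Equiv.sumAssoc _ _ _)).trans (sumAlgEquiv ℂ _ _)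

theorem ambientEquiv_esymmF_XSet (n : ℕ) :
    ambientEquiv N k l iv jv (esymmF (XSet N k l iv jv) n) = esymm _ _ n := by
  rw [← AlgEquiv.coe_toAlgHom, map_esymmF, esymm_eq_multiset_esymm, XSet,
    Finset.image_val_of_injOn (by intro; simp), Multiset.map_map]
  simp [ambientEquiv, sumAlgEquiv_X_inl]

theorem ambientEquiv_esymmF_YSet (n : ℕ) :
    ∃ c, ambientEquiv N k l iv jv (esymmF (YSet N k l iv jv) n) = C c := by
  refine ⟨(Finset.univ.val.map fun i => X (Sum.inl i)).esymm n, ?_⟩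
  rw [← AlgEquiv.coe_toAlgHom, map_esymmF, YSet,
    Finset.image_val_of_injOn (by intro; simp), Multiset.map_map,
    Finset.esymm_map_val, Finset.esymm_map_val]
  simp [ambientEquiv, sumAlgEquiv_X_inr]

theorem isRegularUpTo_esymmF_sub (m : ℕ) (him : ∑ α, iv α = m) :
    IsRegularUpTo (fun t => esymmF (XSet N k l iv jv) (t + 1) - esymmF (YSet N k l iv jv) (t + 1))
      m := by
  choose c hc using ambientEquiv_esymmF_YSet N k l iv jv
  have h := (isRegularUpTo_esymm_sub_C_and_flat (Σ α : Fin k, Fin (iv α))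
    (MvPolynomial ((Σ β : Fin l, Fin (jv β)) ⊕ Fin N) ℂ) fun t => c (t + 1)).1
  rw [Fintype.card_sigma] at h
  simp only [Fintype.card_fin, him] at h
  refine .of_ringEquiv (ambientEquiv N k l iv jv).toRingEquiv ?_
  convert h using 1
  ext1 t
  simp [hc, ambientEquiv_esymmF_XSet]

theorem esymm_difference_regular_sequence (hN : 2 ≤ N) (hk : 1 ≤ k) (hl : 1 ≤ l)
    (hi : ∀ α, 1 ≤ iv α) (hj : ∀ β, 1 ≤ jv β)
    (m : ℕ) (him : ∑ α, iv α = m) (hjm : ∑ β, jv β = m) :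
    ∃ r : Fin m → ↥(Rtil N k l iv jv),
      (∀ t : Fin m, ((r t : MvPolynomial (ambient N k l iv jv) ℂ)) =
          esymmF (XSet N k l iv jv) ((t : ℕ) + 1) -
            esymmF (YSet N k l iv jv) ((t : ℕ) + 1)) ∧
      Ideal.span (Set.range r) ≠ ⊤ ∧
      ∀ t : Fin m, ∀ x : ↥(Rtil N k l iv jv),
        r t * x ∈ Ideal.span (r '' {u : Fin m | u < t}) →
          x ∈ Ideal.span (r '' {u : Fin m | u < t}) := by
  let r : ℕ → Rtil N k l iv jv := fun t => ⟨_, esymmF_sub_mem_Rtil N k l iv jv (t + 1)⟩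
  refine ⟨fun t => r t, fun t => rfl, ?_, fun t x hx => ?_⟩
  · refine ne_top_of_le_ne_top (RingHom.ker_ne_top
      ((constantCoeff (R := ℂ)).comp (Rtil N k l iv jv).val.toRingHom)) ?_
    rw [Ideal.span_le]
    rintro _ ⟨t, rfl⟩
    simp [RingHom.mem_ker, r, constantCoeff_esymmF_succ]
  · have himage : (fun t : Fin m => r t) '' {u | u < t} = r '' Set.Iio (t : ℕ) := by
      ext y
      constructor
      · rintro ⟨u, hu, rfl⟩
        exact ⟨u, hu, rfl⟩
      · rintro ⟨u, hu, rfl⟩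
        exact ⟨⟨u, lt_trans hu t.2⟩, hu, rfl⟩
    rw [himage] at hx ⊢
    refine Ideal.mem_span_of_linear_retraction (blockAverage N k l iv jv)
      (blockAverage_one N k l iv jv) _ ?_
    have := Ideal.mem_map_of_mem
      (algebraMap (Rtil N k l iv jv) (MvPolynomial (ambient N k l iv jv) ℂ)) hx
    rw [Ideal.map_span, map_mul, ← Set.image_comp] at this
    rw [← Set.image_comp]
    exact isRegularUpTo_esymmF_sub N k l iv jv m him t t.2 _ this
end

section
/- (Gaussian elimination) Let 𝒞 be an additive category and let I be a bounded chain complex over 𝒞 of the form ⋯ → C → A⊕D → B⊕E → F → ⋯, where the differential C → A⊕D has components (α, β), the differential A⊕D → B⊕E is given by the matrix (φ δ; γ ε) (i.e. with components φ : A → B, δ : D → B, γ : A → E, ε : D → E), and the differential B⊕E → F has components (μ, ν). If φ : A → B is an isomorphism in 𝒞 with inverse φ⁻¹, then I is chain homotopy equivalent to the bounded complex II = ⋯ → C →(β) D →(ε − γ∘φ⁻¹∘δ) E →(ν) F → ⋯ (all other objects and differentials of the complex unchanged). In particular, if δ = 0 or γ = 0, then I is homotopy equivalent to ⋯ → C →(β)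 D →(ε) E →(ν) F → ⋯. -/
/-!
Statement 10 (Gaussian elimination): Let `𝒞` be an additive category and let `I` be a
bounded cochain complex of the form `⋯ → C → A⊕D → B⊕E → F → ⋯` whose differential
`A⊕D → B⊕E` has matrix `(φ δ; γ ε)` with `φ : A → B` an isomorphism.  Then `I` is chain
homotopy equivalent to the bounded complex `II = ⋯ → C →(β) D →(ε − γφ⁻¹δ) E →(ν) F → ⋯`,
identical to `I` outside the displayed window.
-/

open CategoryTheory CategoryTheory.Limits

/-- A dependent family on `ℤ` can be prescribed separately at `n + 1`, at `n + 2`, and at the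
remaining integers. -/
theorem exists_family_of_window {P : ℤ → Type*} (n : ℤ) (x : P (n + 1)) (y : P (n + 2))
    (z : ∀ i : ℤ, i ≤ n ∨ n + 3 ≤ i → P i) :
    ∃ f : ∀ i, P i, f (n + 1) = x ∧ f (n + 2) = y ∧ ∀ i h, f i = z i h := by
  refine ⟨fun i => if h₁ : i = n + 1 then h₁ ▸ x else if h₂ : i = n + 2 then h₂ ▸ y
    else z i (by omega), ?_, ?_, fun i h => ?_⟩
  · simp
  · simp
  · dsimp only
    rw [dif_neg (by omega), dif_neg (by omega)]

/-- A family of morphisms which commutes with the differentials across the window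
`n, …, n + 3`, and is given elsewhere by a family commuting with the differentials, commutes
with all differentials. -/
theorem comm_of_window {𝒞 : Type*} [Category 𝒞] [HasZeroMorphisms 𝒞]
    {K L : CochainComplex 𝒞 ℤ} (n : ℤ) (f : ∀ i, K.X i ⟶ L.X i)
    (h₀ : f n ≫ L.d n (n + 1) = K.d n (n + 1) ≫ f (n + 1))
    (h₁ : f (n + 1) ≫ L.d (n + 1) (n + 2) = K.d (n + 1) (n + 2) ≫ f (n + 2))
    (h₂ : f (n + 2) ≫ L.d (n + 2) (n + 3) = K.d (n + 2) (n + 3) ≫ f (n + 3))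
    (h : ∀ i : ℤ, (i ≤ n ∨ n + 3 ≤ i) → (i + 1 ≤ n ∨ n + 3 ≤ i + 1) →
      f i ≫ L.d i (i + 1) = K.d i (i + 1) ≫ f (i + 1))
    (i j : ℤ) (hij : (ComplexShape.up ℤ).Rel i j) : f i ≫ L.d i j = K.d i j ≫ f j := by
  replace hij : i + 1 = j := hij
  by_cases e₀ : i = n
  · obtain rfl : j = n + 1 := by omega
    subst e₀
    exact h₀
  by_cases e₁ : i = n + 1
  · obtain rfl : j = n + 2 := by omega
    subst e₁
    exact h₁
  by_cases e₂ : i = n + 2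
  · obtain rfl : j = n + 3 := by omega
    subst e₂
    exact h₂
  subst hij
  exact h i (by omega) (by omega)

/-- A chain endomorphism `p` which is the identity away from degrees `n + 1` and `n + 2`, and
differs from it there by the composites of the differential with a single map `s` in either
order, is homotopic to the identity. -/
theorem nonempty_homotopy_id_of_window {𝒞 : Type*} [Category 𝒞] [Preadditive 𝒞]
    {K : CochainComplex 𝒞 ℤ} (p : K ⟶ K) (n : ℤ) (s : K.X (n + 2) ⟶ K.X (n + 1))
    (h₁ : p.f (n + 1) = K.d (n + 1) (n + 2) ≫ s + 𝟙 _)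
    (h₂ : p.f (n + 2) = s ≫ K.d (n + 1) (n + 2) + 𝟙 _)
    (h : ∀ i : ℤ, i ≤ n ∨ n + 3 ≤ i → p.f i = 𝟙 _) :
    Nonempty (Homotopy p (𝟙 K)) := by
  let H : ∀ i j : ℤ, K.X i ⟶ K.X j := fun i j =>
    if e : n + 2 = i ∧ n + 1 = j then
      eqToHom (by rw [e.1]) ≫ s ≫ eqToHom (by rw [e.2]) else 0
  have Hs : H (n + 2) (n + 1) = s := by simp [H]
  have Hz : ∀ i j : ℤ, ¬(n + 2 = i ∧ n + 1 = j) → H i j = 0 := fun i j e => dif_neg e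
  refine ⟨⟨H, fun i j hij => Hz i j ?_, fun i => ?_⟩⟩
  · rintro ⟨rfl, rfl⟩
    exact hij (show n + 1 + 1 = n + 2 by omega)
  · by_cases e₁ : i = n + 1
    · subst e₁
      rw [dNext_eq H (show (ComplexShape.up ℤ).Rel (n + 1) (n + 2) from
          show n + 1 + 1 = n + 2 by omega),
        prevD_eq H (show (ComplexShape.up ℤ).Rel n (n + 1) from rfl), Hs,
        Hz (n + 1) n (by omega), h₁]
      simp
    by_cases e₂ : i = n + 2
    · subst e₂
      rw [dNext_eq H (show (ComplexShape.up ℤ).Rel (n + 2) (n + 3) from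
          show n + 2 + 1 = n + 3 by omega),
        prevD_eq H (show (ComplexShape.up ℤ).Rel (n + 1) (n + 2) from
          show n + 1 + 1 = n + 2 by omega), Hs,
        Hz (n + 3) (n + 2) (by omega), h₂]
      simp
    · rw [dNext_eq H (show (ComplexShape.up ℤ).Rel i (i + 1) from rfl),
        prevD_eq H (show (ComplexShape.up ℤ).Rel (i - 1) i from
          show i - 1 + 1 = i by omega),
        Hz (i + 1) i (by omega), Hz i (i - 1) (by omega), h i (by omega)]
      simp

theorem gaussian_elimination {𝒞 : Type*} [Category 𝒞] [Preadditive 𝒞]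
    [HasZeroObject 𝒞] [HasBinaryBiproducts 𝒞]
    {A B Cobj D E F : 𝒞}
    (α : Cobj ⟶ A) (β : Cobj ⟶ D) (φ : A ⟶ B) (δ : D ⟶ B) (γ : A ⟶ E) (ε : D ⟶ E)
    (μ : B ⟶ F) (ν : E ⟶ F) [IsIso φ]
    (I II : CochainComplex 𝒞 ℤ) (n : ℤ)
    -- boundedness of both complexes
    (hIbdd : ∃ a b : ℤ, ∀ i : ℤ, i < a ∨ b < i → IsZero (I.X i))
    (hIIbdd : ∃ a b : ℤ, ∀ i : ℤ, i < a ∨ b < i → IsZero (II.X i))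
    -- identification of the window of `I`
    (eC : I.X n ≅ Cobj) (eAD : I.X (n + 1) ≅ A ⊞ D) (eBE : I.X (n + 2) ≅ B ⊞ E)
    (eF : I.X (n + 3) ≅ F)
    (hdI1 : I.d n (n + 1) = eC.hom ≫ biprod.lift α β ≫ eAD.inv)
    (hdI2 : I.d (n + 1) (n + 2) =
      eAD.hom ≫ biprod.desc (biprod.lift φ γ) (biprod.lift δ ε) ≫ eBE.inv)
    (hdI3 : I.d (n + 2) (n + 3) = eBE.hom ≫ biprod.desc μ ν ≫ eF.inv)
    -- identification of the window of `II`
    (fC : II.X n ≅ Cobj) (fD : II.X (n + 1) ≅ D) (fE : II.X (n + 2) ≅ E)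
    (fF : II.X (n + 3) ≅ F)
    (hdII1 : II.d n (n + 1) = fC.hom ≫ β ≫ fD.inv)
    (hdII2 : II.d (n + 1) (n + 2) = fD.hom ≫ (ε - δ ≫ inv φ ≫ γ) ≫ fE.inv)
    (hdII3 : II.d (n + 2) (n + 3) = fE.hom ≫ ν ≫ fF.inv)
    -- outside the window, `I` and `II` agree (via compatible isomorphisms)
    (w : ∀ i : ℤ, i ≤ n ∨ n + 3 ≤ i → (II.X i ≅ I.X i))
    (hw : ∀ (i : ℤ) (h₁ : i ≤ n ∨ n + 3 ≤ i) (h₂ : i + 1 ≤ n ∨ n + 3 ≤ i + 1),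
      II.d i (i + 1) ≫ (w (i + 1) h₂).hom = (w i h₁).hom ≫ I.d i (i + 1))
    (hwn : w n (Or.inl le_rfl) = fC ≪≫ eC.symm)
    (hwn3 : w (n + 3) (Or.inr le_rfl) = fF ≪≫ eF.symm) :
    Nonempty (HomotopyEquiv I II) := by
  have hαβ : α ≫ φ + β ≫ δ = 0 := by
    have h := I.d_comp_d n (n + 1) (n + 2)
    rw [hdI1, hdI2] at h
    have h' := eC.inv ≫= h =≫ (eBE.hom ≫ biprod.fst)
    simpa [biprod.lift_desc] using h'
  have hμν : φ ≫ μ + γ ≫ ν = 0 := by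
    have h := I.d_comp_d (n + 1) (n + 2) (n + 3)
    rw [hdI2, hdI3] at h
    have h' := (biprod.inl ≫ eAD.inv) ≫= h =≫ eF.hom
    simpa [biprod.lift_desc] using h'
  have hα : β ≫ δ ≫ inv φ = -α := by
    rw [← Category.assoc, eq_neg_of_add_eq_zero_right hαβ]
    simp
  have hμ : inv φ ≫ γ ≫ ν = -μ := by
    rw [eq_neg_of_add_eq_zero_right hμν]
    simp
  obtain ⟨f, f₁, f₂, fw⟩ := exists_family_of_window (P := fun i => I.X i ⟶ II.X i) n
    (eAD.hom ≫ biprod.snd ≫ fD.inv)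
    (eBE.hom ≫ biprod.desc (-(inv φ ≫ γ)) (𝟙 E) ≫ fE.inv) (fun i h => (w i h).inv)
  obtain ⟨g, g₁, g₂, gw⟩ := exists_family_of_window (P := fun i => II.X i ⟶ I.X i) n
    (fD.hom ≫ biprod.lift (-(δ ≫ inv φ)) (𝟙 D) ≫ eAD.inv)
    (fE.hom ≫ biprod.inr ≫ eBE.inv) (fun i h => (w i h).hom)
  have f₀ : f n = eC.hom ≫ fC.inv := by rw [fw n (Or.inl le_rfl), hwn]; simp
  have f₃ : f (n + 3) = eF.hom ≫ fF.inv := by rw [fw (n + 3) (Or.inr le_rfl), hwn3]; simp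
  have g₀ : g n = fC.hom ≫ eC.inv := by rw [gw n (Or.inl le_rfl), hwn]; simp
  have g₃ : g (n + 3) = fF.hom ≫ eF.inv := by rw [gw (n + 3) (Or.inr le_rfl), hwn3]; simp
  let F' : I ⟶ II :=
    { f := f
      comm' := by
        refine comm_of_window n f ?_ ?_ ?_ fun i h₁ h₂ => ?_
        · rw [f₀, f₁, hdI1, hdII1]
          simp
        · rw [f₁, f₂, hdI2, hdII2]
          simp only [Category.assoc, Iso.inv_hom_id_assoc, Iso.cancel_iso_hom_left]
          simp only [← Category.assoc, Iso.cancel_iso_inv_right]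
          ext <;> simp [sub_eq_neg_add]
        · rw [f₂, f₃, hdI3, hdII3]
          simp only [Category.assoc, Iso.inv_hom_id_assoc, Iso.cancel_iso_hom_left]
          simp only [← Category.assoc, Iso.cancel_iso_inv_right]
          ext <;> simp [hμ]
        · rw [fw i h₁, fw (i + 1) h₂, Iso.inv_comp_eq, ← Category.assoc, Iso.eq_comp_inv,
            hw i h₁ h₂] }
  let G' : II ⟶ I :=
    { f := g
      comm' := by
        refine comm_of_window n g ?_ ?_ ?_ fun i h₁ h₂ => ?_
        · rw [g₀, g₁, hdI1, hdII1]
          simp only [Category.assoc, Iso.inv_hom_id_assoc, Iso.cancel_iso_hom_left]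
          simp only [← Category.assoc, Iso.cancel_iso_inv_right]
          ext <;> simp [hα]
        · rw [g₁, g₂, hdI2, hdII2]
          simp only [Category.assoc, Iso.inv_hom_id_assoc, Iso.cancel_iso_hom_left]
          simp only [← Category.assoc, Iso.cancel_iso_inv_right]
          ext <;> simp [biprod.lift_desc, sub_eq_neg_add]
        · rw [g₂, g₃, hdI3, hdII3]
          simp
        · rw [gw i h₁, gw (i + 1) h₂, hw i h₁ h₂] }
  have hFG : Nonempty (Homotopy (F' ≫ G') (𝟙 I)) := by
    refine nonempty_homotopy_id_of_window _ n
      (-(eBE.hom ≫ biprod.fst ≫ inv φ ≫ biprod.inl ≫ eAD.inv)) ?_ ?_ fun i h => ?_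
    · change f (n + 1) ≫ g (n + 1) = _
      rw [f₁, g₁, hdI2, ← cancel_epi eAD.inv, ← cancel_mono eAD.hom]
      ext <;> simp
    · change f (n + 2) ≫ g (n + 2) = _
      rw [f₂, g₂, hdI2, ← cancel_epi eBE.inv, ← cancel_mono eBE.hom]
      ext <;> simp
    · change f i ≫ g i = _
      rw [fw i h, gw i h, Iso.inv_hom_id]
  have hGF : G' ≫ F' = 𝟙 II := by
    ext i
    change g i ≫ f i = 𝟙 _
    by_cases e₁ : i = n + 1
    · subst e₁
      rw [g₁, f₁]
      simp
    by_cases e₂ : i = n + 2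
    · subst e₂
      rw [g₂, f₂]
      simp
    · rw [gw i (by omega), fw i (by omega), Iso.hom_inv_id]
  exact hFG.map fun h => ⟨F', G', h, Homotopy.ofEq hGF⟩
end

section
/- Fix an integer N ≥ 2 and ε₀ ∈ ℤ/2. Let M⁰ and M¹ be ℤ-graded ℂ-vector spaces whose gradings are bounded below, and for each ε ∈ ℤ/2 let d_ε : M^ε → M^{ε+1} be a linear map admitting a decomposition d_ε = Σ_{l=0}^{N} d_ε^{(l)}, where d_ε^{(l)} is homogeneous of degree N+1−2l; assume d_{ε+1} ∘ d_ε = 0 for both ε. If the leading complex is exact at M^{ε₀−1}, i.e. ker d^{(0)}_{ε₀−1} = im d^{(0)}_{ε₀}, then the full complex is exact at M^{ε₀−1}: ker d_{ε₀−1} = im d_{ε₀}. -/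
open DirectSum in
/-- A homogeneous linear map of degree `c` commutes with taking graded components, up to a
shift by `c`. -/
theorem decompose_apply_of_homogeneous {R V W : Type*} [Semiring R]
    [AddCommMonoid V] [Module R V] [AddCommMonoid W] [Module R W]
    (𝒜 : ℤ → Submodule R V) (ℬ : ℤ → Submodule R W) [Decomposition 𝒜] [Decomposition ℬ]
    (f : V →ₗ[R] W) (c : ℤ) (hf : ∀ g, ∀ x ∈ 𝒜 g, f x ∈ ℬ (g + c)) (x : V) (g : ℤ) :
    (decompose ℬ (f x) g : W) = f (decompose 𝒜 x (g - c)) := by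
  induction x using Decomposition.inductionOn 𝒜 with
  | zero => simp
  | @homogeneous i m =>
    by_cases h : i = g - c
    · have hm : f m ∈ ℬ g := by simpa [h] using hf i m m.2
      subst h
      rw [decompose_of_mem_same ℬ hm, decompose_of_mem_same 𝒜 m.2]
    · rw [decompose_of_mem_ne ℬ (hf i m m.2) (by omega), decompose_of_mem_ne 𝒜 m.2 h, map_zero]
  | add a b ha hb => simp [ha, hb]

open DirectSum in
theorem decompose_sum_apply_of_homogeneous {ι R V W : Type*} [Semiring R]
    [AddCommMonoid V] [Module R V] [AddCommMonoid W] [Module R W]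
    (𝒜 : ℤ → Submodule R V) (ℬ : ℤ → Submodule R W) [Decomposition 𝒜] [Decomposition ℬ]
    (s : Finset ι) (f : ι → V →ₗ[R] W) (c : ι → ℤ)
    (hf : ∀ l g, ∀ x ∈ 𝒜 g, f l x ∈ ℬ (g + c l)) (x : V) (g : ℤ) :
    (decompose ℬ ((∑ l ∈ s, f l) x) g : W) = ∑ l ∈ s, f l (decompose 𝒜 x (g - c l)) := by
  classical
  induction s using Finset.induction_on with
  | empty => simp
  | insert a s ha ih =>
    rw [Finset.sum_insert ha, Finset.sum_insert ha, LinearMap.add_apply, decompose_add,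
      DirectSum.add_apply, Submodule.coe_add, ih,
      decompose_apply_of_homogeneous 𝒜 ℬ (f a) (c a) (hf a) x g]

theorem full_exactness_of_leading_exactness (N : ℕ) (hN : 2 ≤ N)
    {V W : Type*} [AddCommGroup V] [Module ℂ V] [AddCommGroup W] [Module ℂ W]
    (𝒜 : ℤ → Submodule ℂ V) (ℬ : ℤ → Submodule ℂ W)
    (hVint : DirectSum.IsInternal 𝒜) (hWint : DirectSum.IsInternal ℬ)
    (hVbdd : ∃ g₀ : ℤ, ∀ g < g₀, 𝒜 g = ⊥) (hWbdd : ∃ g₀ : ℤ, ∀ g < g₀, ℬ g = ⊥)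
    (d : V →ₗ[ℂ] W) (d' : W →ₗ[ℂ] V)
    (du : Fin (N + 1) → (V →ₗ[ℂ] W)) (dv : Fin (N + 1) → (W →ₗ[ℂ] V))
    (hdu : d = ∑ l : Fin (N + 1), du l) (hdv : d' = ∑ l : Fin (N + 1), dv l)
    (hduhom : ∀ (l : Fin (N + 1)) (g : ℤ), ∀ x ∈ 𝒜 g,
      du l x ∈ ℬ (g + ((N : ℤ) + 1 - 2 * (l : ℕ))))
    (hdvhom : ∀ (l : Fin (N + 1)) (g : ℤ), ∀ y ∈ ℬ g,
      dv l y ∈ 𝒜 (g + ((N : ℤ) + 1 - 2 * (l : ℕ))))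
    (hdd : ∀ x : V, d' (d x) = 0) (hdd' : ∀ y : W, d (d' y) = 0)
    (hlead : LinearMap.ker (dv 0) = LinearMap.range (du 0)) :
    LinearMap.ker d' = LinearMap.range d := by
  classical
  let _ := hVint.chooseDecomposition
  let _ := hWint.chooseDecomposition
  have hd (x : V) (g : ℤ) : (DirectSum.decompose ℬ (d x) g : W) =
      ∑ l, du l (DirectSum.decompose 𝒜 x (g - ((N : ℤ) + 1 - 2 * (l : ℕ)))) := by
    rw [hdu]
    exact decompose_sum_apply_of_homogeneous 𝒜 ℬ _ du _ hduhom x g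
  have hd' (y : W) (g : ℤ) : (DirectSum.decompose 𝒜 (d' y) g : V) =
      ∑ l, dv l (DirectSum.decompose ℬ y (g - ((N : ℤ) + 1 - 2 * (l : ℕ)))) := by
    rw [hdv]
    exact decompose_sum_apply_of_homogeneous ℬ 𝒜 _ dv _ hdvhom y g
  have shift (g : ℤ) : g - ((N : ℤ) + 1 - 2 * ((0 : Fin (N + 1)) : ℕ)) = g - (N + 1) := by simp
  obtain ⟨g₀, hg₀⟩ := hWbdd
  have key (n : ℕ) : ∀ y : W, (∀ h, g₀ + n ≤ h → (DirectSum.decompose ℬ y h : W) = 0) →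
      d' y = 0 → y ∈ LinearMap.range d := by
    induction n with
    | zero =>
      intro y hy _
      have hy0 : y = 0 := by
        apply (DirectSum.decompose ℬ).injective
        ext h
        rw [DirectSum.decompose_zero]
        by_cases hh : g₀ ≤ h
        · simpa using hy h (by simpa using hh)
        · have := (DirectSum.decompose ℬ y h).2
          simpa using (Submodule.eq_bot_iff _).1 (hg₀ h (by omega)) _ this
      exact hy0 ▸ zero_mem _
    | succ n ih =>
      intro y hy hdy
      set g : ℤ := g₀ + n
      have ha : dv 0 (DirectSum.decompose ℬ y g) = 0 := by
        have h := hd' y (g + (N + 1))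
        rw [hdy, Fin.sum_univ_succ, shift, add_sub_cancel_right, Finset.sum_eq_zero] at h
        · simpa using h.symm
        · intro l _
          rw [hy _ (by push_cast [Fin.val_succ]; omega), map_zero]
      obtain ⟨x, hx⟩ : (DirectSum.decompose ℬ y g : W) ∈ LinearMap.range (du 0) :=
        hlead ▸ LinearMap.mem_ker.2 ha
      have hx' : du 0 (DirectSum.decompose 𝒜 x (g - (N + 1))) =
          (DirectSum.decompose ℬ y g : W) := by
        have h := decompose_apply_of_homogeneous 𝒜 ℬ (du 0) _ (hduhom 0) x g
        rw [hx, shift, DirectSum.decompose_of_mem_same ℬ (SetLike.coe_mem _)] at h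
        exact h.symm
      set x' : V := ((DirectSum.decompose 𝒜 x (g - (N + 1)) : 𝒜 (g - (N + 1))) : V)
      have hx'mem : x' ∈ 𝒜 (g - (N + 1)) := SetLike.coe_mem _
      have hz : y - d x' ∈ LinearMap.range d := by
        refine ih _ (fun h hh ↦ ?_) (by rw [map_sub, hdy, hdd, sub_zero])
        rw [DirectSum.decompose_sub, DirectSum.sub_apply, AddSubgroupClass.coe_sub, hd,
          Fin.sum_univ_succ, Finset.sum_eq_zero, add_zero, sub_eq_zero]
        · obtain rfl | hlt := hh.eq_or_lt
          · rw [shift, DirectSum.decompose_of_mem_same 𝒜 hx'mem, hx']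
          · rw [hy h (by push_cast; omega), DirectSum.decompose_of_mem_ne 𝒜 hx'mem
              (by simp; omega), map_zero]
        · intro l _
          rw [DirectSum.decompose_of_mem_ne 𝒜 hx'mem (by push_cast [Fin.val_succ]; omega),
            map_zero]
      simpa using add_mem hz (LinearMap.mem_range_self d x')
  refine le_antisymm (fun y hy ↦ ?_) ?_
  · obtain ⟨b, hb⟩ := (DirectSum.decompose ℬ y).support.bddAbove
    refine key (b + 1 - g₀).toNat y (fun h hh ↦ ?_) hy
    by_contra hne
    have : h ≤ b := hb (by simpa using hne)
    omega
  · rintro _ ⟨x, rfl⟩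
    exact hdd x
end
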